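/- arXiv:2605.19096 — 2 statements merged into one kernel-verified Lean document; each statement's English description precedes it below -/
import Mathlib

section
/- Let Ω ∈ K^{n×ℓ} be any random embedding that has full column rank almost surely. For any problem dimension d ∈ ℕ and any rank parameters q, r ∈ ℕ with q + α_K < ℓ ≤ r ≤ min(d, n), the supremum over all matrices A ∈ K^{d×n} with rank(A) = r of the ratio E‖A − Π_{AΩ}A‖_F² / ‖A − [A]_q‖_F² is at least ((r − ℓ)/(r − q)) · (1 + q/(ℓ − q − α_K)). -/
open MeasureTheory ProbabilityTheory Matrix Filter
open scoped ENNReal Topology ComplexOrder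

noncomputable section

open Classical in
/-- `α_K`: 1 if `K = ℝ`, 0 if `K = ℂ`. -/
def alphaK (K : Type*) [RCLike K] : ℝ := if (RCLike.I : K) = 0 then 1 else 0

/-- Squared Frobenius norm of a matrix. -/
def frobSq {K : Type*} [RCLike K] {m n : Type*} [Fintype m] [Fintype n]
    (A : Matrix m n K) : ℝ := ∑ i, ∑ j, ‖A i j‖ ^ 2

/-- The four Penrose conditions characterizing the Moore–Penrose pseudoinverse. -/
def IsMoorePenrose {K : Type*} [RCLike K] {m n : Type*} [Fintype m] [Fintype n]
    (A : Matrix m n K) (X : Matrix n m K) : Prop :=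
  A * X * A = A ∧ X * A * X = X ∧ (A * X)ᴴ = A * X ∧ (X * A)ᴴ = X * A

instance matrixMeasurableSpace {m n α : Type*} [MeasurableSpace α] :
    MeasurableSpace (Matrix m n α) :=
  inferInstanceAs (MeasurableSpace (m → n → α))

/-- `M` is rotation-invariant: `U * M` has the same distribution as `M` for every unitary `U`. -/
def RotationInvariant {K : Type*} [RCLike K] [MeasurableSpace K]
    {Y : Type*} [MeasurableSpace Y] (μ : Measure Y) {n ℓ : ℕ}
    (M : Y → Matrix (Fin n) (Fin ℓ) K) : Prop :=
  ∀ U : Matrix (Fin n) (Fin n) K, U ∈ Matrix.unitaryGroup (Fin n) K →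
    Measure.map (fun ω => U * M ω) μ = Measure.map M μ

/-- `M` is a random orthonormal embedding: rotation-invariant, with orthonormal
columns almost surely. -/
def IsRandomOrthonormal {K : Type*} [RCLike K] [MeasurableSpace K]
    {Y : Type*} [MeasurableSpace Y] (μ : Measure Y) {n ℓ : ℕ}
    (M : Y → Matrix (Fin n) (Fin ℓ) K) : Prop :=
  Measurable M ∧ RotationInvariant μ M ∧ ∀ᵐ ω ∂μ, (M ω)ᴴ * M ω = 1

/-- `Aq` is a best rank-`q` approximation of `A` in Frobenius norm
(equivalently, a matrix obtained from a `q`-truncated SVD of `A`). -/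
def IsBestRankApprox {K : Type*} [RCLike K] {m n : Type*} [Fintype m] [Fintype n]
    [DecidableEq n] (q : ℕ) (A Aq : Matrix m n K) : Prop :=
  Aq.rank ≤ q ∧ ∀ B : Matrix m n K, B.rank ≤ q → frobSq (A - Aq) ≤ frobSq (A - B)


lemma radial_gauss {E : Type*} [NormedAddCommGroup E] [InnerProductSpace ℝ E]
    [FiniteDimensional ℝ E] [MeasurableSpace E] [BorelSpace E] [Nontrivial E] (s : ℝ)
    (hs : 0 < (Module.finrank ℝ E : ℝ) + s) :
    ∫ x : E, ‖x‖ ^ s * Real.exp (-‖x‖ ^ (2:ℝ)) =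
      ((Module.finrank ℝ E : ℝ) * (volume : Measure E).real (Metric.ball 0 1)) *
        (1 / 2 * Real.Gamma (((Module.finrank ℝ E : ℝ) + s) / 2)) := by
  have hn : 0 < Module.finrank ℝ E := Module.finrank_pos
  rw [integral_fun_norm_addHaar (volume : Measure E) (fun y => y ^ s * Real.exp (-y ^ (2:ℝ)))]
  have h : ∫ y in Set.Ioi (0:ℝ), y ^ (Module.finrank ℝ E - 1) • (y ^ s * Real.exp (-y ^ (2:ℝ)))
      = ∫ y in Set.Ioi (0:ℝ), y ^ ((Module.finrank ℝ E : ℝ) - 1 + s) * Real.exp (-y ^ (2:ℝ)) := by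
    refine setIntegral_congr_fun measurableSet_Ioi (fun y hy => ?_)
    have hy : 0 < y := hy
    simp only [smul_eq_mul]
    rw [Real.rpow_add hy, ← mul_assoc, ← Real.rpow_natCast, Nat.cast_sub hn, Nat.cast_one]
  rw [h, integral_rpow_mul_exp_neg_rpow (by norm_num) (by linarith)]
  simp only [nsmul_eq_mul, smul_eq_mul, mul_assoc]
  congr 5
  ring

lemma radial_gauss_pos {E : Type*} [NormedAddCommGroup E] [InnerProductSpace ℝ E]
    [FiniteDimensional ℝ E] [MeasurableSpace E] [BorelSpace E] [Nontrivial E] (s : ℝ)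
    (hs : 0 < (Module.finrank ℝ E : ℝ) + s) :
    0 < ∫ x : E, ‖x‖ ^ s * Real.exp (-‖x‖ ^ (2:ℝ)) := by
  rw [radial_gauss s hs]
  have hn : 0 < Module.finrank ℝ E := Module.finrank_pos
  have : 0 < (volume : Measure E).real (Metric.ball 0 1) :=
    ENNReal.toReal_pos (Metric.measure_ball_pos _ _ one_pos).ne' measure_ball_lt_top.ne
  have := Real.Gamma_pos_of_pos (s := ((Module.finrank ℝ E : ℝ) + s) / 2) (by linarith)
  positivity

lemma radial_gauss_lint {E : Type*} [NormedAddCommGroup E] [InnerProductSpace ℝ E]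
    [FiniteDimensional ℝ E] [MeasurableSpace E] [BorelSpace E] [Nontrivial E] (s : ℝ)
    (hs : 0 < (Module.finrank ℝ E : ℝ) + s) :
    ∫⁻ x : E, ENNReal.ofReal (‖x‖ ^ s * Real.exp (-‖x‖ ^ (2:ℝ))) =
      ENNReal.ofReal (∫ x : E, ‖x‖ ^ s * Real.exp (-‖x‖ ^ (2:ℝ))) := by
  rw [ofReal_integral_eq_lintegral_ofReal]
  · exact Integrable.of_integral_ne_zero (radial_gauss_pos s hs).ne'
  · exact Eventually.of_forall fun x => by positivity

/-- The Gaussian weight. -/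
def gw {E : Type*} [NormedAddCommGroup E] (x : E) : ℝ≥0∞ := ENNReal.ofReal (Real.exp (-‖x‖ ^ 2))

lemma gw_meas {E : Type*} [NormedAddCommGroup E] [MeasurableSpace E] [BorelSpace E] :
    Measurable (gw : E → ℝ≥0∞) := by
  unfold gw; fun_prop

lemma gauss_mass {E : Type*} [NormedAddCommGroup E] [InnerProductSpace ℝ E]
    [FiniteDimensional ℝ E] [MeasurableSpace E] [BorelSpace E] [Nontrivial E] :
    ∫⁻ x : E, gw x = ENNReal.ofReal (∫ x : E, ‖x‖ ^ (0:ℝ) * Real.exp (-‖x‖ ^ (2:ℝ))) := by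
  have hn : 0 < Module.finrank ℝ E := Module.finrank_pos
  rw [← radial_gauss_lint 0 (by simpa using hn)]
  simp [gw]

lemma gauss_mass_ne {E : Type*} [NormedAddCommGroup E] [InnerProductSpace ℝ E]
    [FiniteDimensional ℝ E] [MeasurableSpace E] [BorelSpace E] [Nontrivial E] :
    ∫⁻ x : E, gw x ≠ 0 ∧ ∫⁻ x : E, gw x ≠ ⊤ := by
  have hn : 0 < Module.finrank ℝ E := Module.finrank_pos
  rw [gauss_mass]
  have := radial_gauss_pos (E := E) 0 (by simpa using hn)
  exact ⟨by simpa using this, by simp⟩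

lemma gauss_sq {E : Type*} [NormedAddCommGroup E] [InnerProductSpace ℝ E]
    [FiniteDimensional ℝ E] [MeasurableSpace E] [BorelSpace E] [Nontrivial E] :
    ∫⁻ x : E, ENNReal.ofReal (‖x‖ ^ 2) * gw x =
      ENNReal.ofReal ((Module.finrank ℝ E : ℝ) / 2) * ∫⁻ x : E, gw x := by
  have hn : 0 < (Module.finrank ℝ E : ℝ) := by exact_mod_cast Module.finrank_pos (R := ℝ) (M := E)
  have h1 : ∫⁻ x : E, ENNReal.ofReal (‖x‖ ^ 2) * gw x
     = ∫⁻ x : E, ENNReal.ofReal (‖x‖ ^ (2:ℝ) * Real.exp (-‖x‖ ^ (2:ℝ))) := by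
    refine lintegral_congr fun x => ?_
    rw [gw, ← ENNReal.ofReal_mul (by positivity)]
    simp
  rw [h1, radial_gauss_lint 2 (by linarith), gauss_mass, ← ENNReal.ofReal_mul (by positivity),
    radial_gauss 2 (by linarith), radial_gauss 0 (by linarith)]
  congr 1
  have : ((Module.finrank ℝ E : ℝ) + 2) / 2 = ((Module.finrank ℝ E : ℝ) + 0) / 2 + 1 := by ring
  rw [this, Real.Gamma_add_one (by positivity)]
  ring

lemma gauss_inv {E : Type*} [NormedAddCommGroup E] [InnerProductSpace ℝ E]
    [FiniteDimensional ℝ E] [MeasurableSpace E] [BorelSpace E] (h2 : 2 < Module.finrank ℝ E) :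
    ∫⁻ x : E, ENNReal.ofReal ((‖x‖ ^ 2)⁻¹) * gw x =
      ENNReal.ofReal (2 / ((Module.finrank ℝ E : ℝ) - 2)) * ∫⁻ x : E, gw x := by
  have : Nontrivial E := Module.nontrivial_of_finrank_pos (R := ℝ) (by omega)
  have hn : 2 < (Module.finrank ℝ E : ℝ) := by exact_mod_cast h2
  have h1 : ∫⁻ x : E, ENNReal.ofReal ((‖x‖ ^ 2)⁻¹) * gw x
     = ∫⁻ x : E, ENNReal.ofReal (‖x‖ ^ (-2:ℝ) * Real.exp (-‖x‖ ^ (2:ℝ))) := by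
    refine lintegral_congr fun x => ?_
    rw [gw, ← ENNReal.ofReal_mul (by positivity), Real.rpow_neg (norm_nonneg _)]
    simp
  have h3 : 0 < (Module.finrank ℝ E : ℝ) - 2 := by linarith
  rw [h1, radial_gauss_lint (-2) (by linarith), gauss_mass, ← ENNReal.ofReal_mul (by positivity),
    radial_gauss (-2) (by linarith), radial_gauss 0 (by linarith)]
  congr 1
  have : ((Module.finrank ℝ E : ℝ) + 0) / 2 = ((Module.finrank ℝ E : ℝ) + -2) / 2 + 1 := by ring
  rw [this, Real.Gamma_add_one (by linarith)]
  field_simp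
  ring

lemma gauss_ratio {E : Type*} [NormedAddCommGroup E] [InnerProductSpace ℝ E]
    [FiniteDimensional ℝ E] [MeasurableSpace E] [BorelSpace E] (S : Submodule ℝ E)
    (h2 : 2 < Module.finrank ℝ Sᗮ) :
    ∫⁻ x : E, ENNReal.ofReal (‖S.orthogonalProjectionOnto x‖ ^ 2 * (‖Sᗮ.orthogonalProjectionOnto x‖ ^ 2)⁻¹) * gw x =
      ENNReal.ofReal ((Module.finrank ℝ S : ℝ) / ((Module.finrank ℝ Sᗮ : ℝ) - 2)) * ∫⁻ x : E, gw x := by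
  have hn : 2 < (Module.finrank ℝ Sᗮ : ℝ) := by exact_mod_cast h2
  have h3 : 0 < (Module.finrank ℝ Sᗮ : ℝ) - 2 := by linarith
  have mp : MeasurePreserving (fun x : E => (S.orthogonalProjectionOnto x, Sᗮ.orthogonalProjectionOnto x))
      volume (volume.prod volume) := by
    have h := (WithLp.volume_preserving_ofLp S Sᗮ).comp S.orthogonalDecomposition.measurePreserving
    have e : (WithLp.ofLp ∘ S.orthogonalDecomposition : E → S × Sᗮ) =
        fun x : E => (S.orthogonalProjectionOnto x, Sᗮ.orthogonalProjectionOnto x) := by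
      funext x
      simp
    rw [e] at h
    exact h
  have hgw : ∀ x : E, gw x = gw (S.orthogonalProjectionOnto x) * gw (Sᗮ.orthogonalProjectionOnto x) := by
    intro x
    simp only [gw]
    rw [← ENNReal.ofReal_mul (by positivity), ← Real.exp_add]
    have := S.norm_sq_eq_add_norm_sq_projection x
    congr 2
    rw [this]; ring
  have e1 : ∫⁻ x : E, gw x = (∫⁻ x : S, gw x) * ∫⁻ x : Sᗮ, gw x := by
    rw [← lintegral_prod_mul gw_meas.aemeasurable gw_meas.aemeasurable,
      ← mp.lintegral_comp (by
        exact (gw_meas.comp measurable_fst).mul (gw_meas.comp measurable_snd))]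
    exact lintegral_congr hgw
  have e2 : ∫⁻ x : E, ENNReal.ofReal (‖S.orthogonalProjectionOnto x‖ ^ 2 * (‖Sᗮ.orthogonalProjectionOnto x‖ ^ 2)⁻¹) * gw x
     = (∫⁻ x : S, ENNReal.ofReal (‖x‖ ^ 2) * gw x) * ∫⁻ x : Sᗮ, ENNReal.ofReal ((‖x‖ ^ 2)⁻¹) * gw x := by
    have m1 : Measurable (fun x : S => ENNReal.ofReal (‖x‖ ^ 2) * gw x) := by
      unfold gw; fun_prop
    have m2 : Measurable (fun x : Sᗮ => ENNReal.ofReal ((‖x‖ ^ 2)⁻¹) * gw x) := by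
      unfold gw; fun_prop
    rw [← lintegral_prod_mul m1.aemeasurable m2.aemeasurable,
      ← mp.lintegral_comp (by
        exact (m1.comp measurable_fst).mul (m2.comp measurable_snd))]
    refine lintegral_congr fun x => ?_
    rw [hgw, ENNReal.ofReal_mul (by positivity)]
    ring
  rw [e2, e1, gauss_inv h2]
  rcases Nat.eq_zero_or_pos (Module.finrank ℝ S) with h0 | h0
  · have : Subsingleton S := Module.finrank_zero_iff.mp h0
    have : ∀ x : S, ‖x‖ = 0 := fun x => by rw [Subsingleton.elim x 0, norm_zero]
    simp [h0, this]
  · have : Nontrivial S := Module.nontrivial_of_finrank_pos (R := ℝ) h0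
    rw [gauss_sq]
    have : ENNReal.ofReal ((Module.finrank ℝ S : ℝ) / ((Module.finrank ℝ Sᗮ : ℝ) - 2)) =
      ENNReal.ofReal ((Module.finrank ℝ S : ℝ) / 2) * ENNReal.ofReal (2 / ((Module.finrank ℝ Sᗮ : ℝ) - 2)) := by
      rw [← ENNReal.ofReal_mul (by positivity)]
      congr 1; field_simp
    rw [this]; ring

/-! ### Householder reflections -/

section Householder

set_option linter.unusedSectionVars false

variable {K : Type*} [RCLike K] {ι : Type*} [Fintype ι] [DecidableEq ι]

/-- Sum of squares of the entries. -/
def nsq (g : ι → K) : ℝ := ∑ j, ‖g j‖ ^ 2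

/-- A phase of a scalar. -/
def phase (z : K) : K := if z = 0 then 1 else z / (‖z‖ : K)

lemma phase_norm (z : K) : ‖phase z‖ = 1 := by
  unfold phase
  split_ifs with h
  · simp
  · have : ‖z‖ ≠ 0 := by simpa using h
    simp [this]

lemma phase_mul (z : K) : phase z * (‖z‖ : K) = z := by
  unfold phase
  split_ifs with h
  · simp [h]
  · have : (‖z‖ : K) ≠ 0 := by simpa using h
    field_simp

/-- The Householder vector. -/
def hhv (i : ι) (g : ι → K) : ι → K :=
  g + Pi.single i (((Real.sqrt (nsq g) : ℝ) : K) * phase (g i))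

/-- The Householder matrix. -/
def hhm (i : ι) (g : ι → K) : Matrix ι ι K :=
  1 - (((2 / nsq (hhv i g) : ℝ) : K)) • vecMulVec (hhv i g) (star (hhv i g))

lemma star_dot_self (v : ι → K) : star v ⬝ᵥ v = ((nsq v : ℝ) : K) := by
  simp only [dotProduct, nsq, Pi.star_apply, RCLike.star_def, RCLike.conj_mul]
  push_cast
  rfl

lemma hhm_herm (i : ι) (g : ι → K) : (hhm i g)ᴴ = hhm i g := by
  unfold hhm
  rw [conjTranspose_sub, conjTranspose_one, conjTranspose_smul, conjTranspose_vecMulVec, star_star,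
    RCLike.star_def, RCLike.conj_ofReal]

lemma hhm_unitary (i : ι) (g : ι → K) : hhm i g ∈ Matrix.unitaryGroup ι K := by
  rw [Matrix.mem_unitaryGroup_iff, star_eq_conjTranspose, hhm_herm]
  unfold hhm
  set v := hhv i g
  have h : vecMulVec v (star v) * vecMulVec v (star v) = ((nsq v : ℝ) : K) • vecMulVec v (star v) := by
    rw [vecMulVec_mul_vecMulVec, star_dot_self, vecMulVec_smul]
  rw [sub_mul, mul_sub, mul_sub, mul_one, mul_one, one_mul, smul_mul_smul_comm, h, smul_smul]
  have h2 : (((2 / nsq v : ℝ) : K) * ((2 / nsq v : ℝ) : K)) * ((nsq v : ℝ) : K)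
      = 2 * ((2 / nsq v : ℝ) : K) := by
    rcases eq_or_ne (nsq v) 0 with h0 | h0
    · simp [h0]
    · norm_cast
      field_simp
  rw [h2, two_mul, add_smul]
  abel

lemma hhm_mulVec (i : ι) (g p : ι → K) :
    hhm i g *ᵥ p = p - (((2 / nsq (hhv i g) : ℝ) : K) * (star (hhv i g) ⬝ᵥ p)) • hhv i g := by
  unfold hhm
  rw [sub_mulVec, one_mulVec, smul_mulVec, vecMulVec_mulVec, op_smul_eq_smul, smul_smul]

lemma hhm_off (i : ι) (g p : ι → K) (j : ι) (hj : j ≠ i) (hg : g j = 0) :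
    (hhm i g *ᵥ p) j = p j := by
  rw [hhm_mulVec]
  simp [hhv, hj, hg]

lemma nsq_nonneg (g : ι → K) : 0 ≤ nsq g := Finset.sum_nonneg fun _ _ => by positivity

lemma hhm_at (i : ι) (g p : ι → K) :
    Real.sqrt (nsq g) * ‖(hhm i g *ᵥ p) i‖ = ‖star g ⬝ᵥ p‖ := by
  rcases eq_or_ne g 0 with rfl | hg
  · simp [nsq]
  set N := Real.sqrt (nsq g) with hN
  have hpos : 0 < nsq g := by
    refine lt_of_le_of_ne (nsq_nonneg g) (fun h => hg ?_)
    have := (Finset.sum_eq_zero_iff_of_nonneg (fun j _ => by positivity)).mp h.symm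
    funext j
    simpa using this j (Finset.mem_univ j)
  have hNp : 0 < N := Real.sqrt_pos.mpr hpos
  have hN2 : N ^ 2 = nsq g := Real.sq_sqrt hpos.le
  set θ := phase (g i) with hθ
  have hθn : star θ * θ = 1 := by
    rw [RCLike.star_def, RCLike.conj_mul, phase_norm]; simp
  have hθg : star θ * g i = (‖g i‖ : K) := by
    conv_lhs => rw [← phase_mul (g i), ← hθ, ← mul_assoc, hθn, one_mul]
  have hgθ : star (g i) * θ = (‖g i‖ : K) := by
    have := congrArg star hθg
    simpa [mul_comm] using this
  have hv : hhv i g = g + Pi.single i ((N : K) * θ) := rfl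
  have hvi : hhv i g i = θ * (‖g i‖ + N : K) := by
    rw [hv]
    simp only [Pi.add_apply, Pi.single_eq_same]
    conv_lhs => rw [← phase_mul (g i), ← hθ]
    ring
  have hdot : ∀ x : ι → K, star (hhv i g) ⬝ᵥ x = star g ⬝ᵥ x + (N : K) * star θ * x i := by
    intro x
    rw [hv, star_add, add_dotProduct, Pi.star_single, single_dotProduct]
    simp
  have hs : nsq (hhv i g) = 2 * N * (‖g i‖ + N) := by
    have h1 : ((nsq (hhv i g) : ℝ) : K) = ((2 * N * (‖g i‖ + N) : ℝ) : K) := by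
      rw [← star_dot_self, hdot, hvi]
      conv_lhs => rw [hv, dotProduct_add, star_dot_self, dotProduct_single, ← hN2]
      rw [Pi.star_apply]
      push_cast
      linear_combination (N : K) * hgθ + (N:K) * (‖g i‖ + N : K) * hθn
    exact_mod_cast h1
  have hkey : (N : K) * (hhm i g *ᵥ p) i = - θ * (star g ⬝ᵥ p) := by
    rw [hhm_mulVec]
    simp only [Pi.sub_apply, Pi.smul_apply, smul_eq_mul]
    rw [hdot, hvi, hs]
    have h1 : (N : K) ≠ 0 := by exact_mod_cast hNp.ne'
    have h2 : (‖g i‖ + N : K) ≠ 0 := by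
      have : ‖g i‖ + N ≠ 0 := by positivity
      exact_mod_cast this
    push_cast
    field_simp
    linear_combination (-(N : K)) * p i * hθn
  have := congrArg norm hkey
  rw [norm_mul, norm_mul, norm_neg, phase_norm, one_mul] at this
  rw [← this]
  simp [abs_of_pos hNp]

variable [MeasurableSpace K] [BorelSpace K]

lemma phase_meas : Measurable (phase : K → K) := by
  unfold phase
  refine Measurable.ite (measurableSet_singleton 0) measurable_const ?_
  fun_prop

lemma nsq_meas : Measurable (nsq : (ι → K) → ℝ) := by
  unfold nsq; fun_prop

lemma hhv_meas (i : ι) : Measurable (hhv (K := K) i) := by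
  rw [measurable_pi_iff]
  intro j
  unfold hhv
  have := phase_meas (K := K)
  have := nsq_meas (K := K) (ι := ι)
  by_cases h : j = i
  · subst h
    simp only [Pi.add_apply, Pi.single_eq_same]
    fun_prop
  · simp only [Pi.add_apply, ne_eq, h, not_false_eq_true, Pi.single_eq_of_ne, add_zero]
    fun_prop

lemma hhm_meas (i : ι) : Measurable (hhm (K := K) i) := by
  refine measurable_pi_iff.mpr fun a => measurable_pi_iff.mpr fun b => ?_
  have h1 := hhv_meas (K := K) i
  have h1' : ∀ j, Measurable (fun g : ι → K => hhv i g j) := fun j => measurable_pi_iff.mp h1 j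
  have h2 := (nsq_meas (K := K) (ι := ι)).comp h1
  have h3 : Measurable (fun g : ι → K => nsq (hhv i g)) := h2
  have e : (fun g : ι → K => hhm i g a b) = fun g => (1 : Matrix ι ι K) a b
      - ((2 / nsq (hhv i g) : ℝ) : K) * (hhv i g a * (starRingEnd K) (hhv i g b)) := by
    funext g
    simp [hhm, vecMulVec_apply]
  change Measurable (fun g : ι → K => hhm i g a b)
  rw [e]
  have ha := h1' a
  have hb := h1' b
  have hb' : Measurable (fun g : ι → K => (starRingEnd K) (hhv i g b)) :=
    RCLike.continuous_conj.measurable.comp hb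
  fun_prop

end Householder

/-! ### The penalized objective -/

section Objective

variable {K : Type*} [RCLike K] {r ℓ : ℕ}

/-- Weights: `(N+1)^2` on the first `q` coordinates, `1` elsewhere. -/
def wt (q N : ℕ) (j : Fin r) : ℝ := if j.val < q then ((N : ℝ) + 1) ^ 2 else 1

lemma wt_pos (q N : ℕ) (j : Fin r) : 0 < wt q N j := by
  unfold wt; split_ifs <;> positivity

lemma wt_mono (q : ℕ) (j : Fin r) {N N' : ℕ} (h : N ≤ N') : wt q N j ≤ wt q N' j := by
  unfold wt
  split_ifs
  · gcongr
  · exact le_rfl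

/-- Penalized objective. -/
def fval (q N : ℕ) (i : Fin r) (z : Fin r → K) : ℝ :=
  ∑ j, wt q N j * ‖(Pi.single i 1 : Fin r → K) j - z j‖ ^ 2

/-- Penalized minimum. -/
def fmin (q N : ℕ) (i : Fin r) (Z : Matrix (Fin r) (Fin ℓ) K) : ℝ≥0∞ :=
  ⨅ w : Fin ℓ → K, ENNReal.ofReal (fval q N i (Z *ᵥ w))

/-- The damping factor. -/
def kap (N : ℕ) : ℝ := 1 - (1 / ((N : ℝ) + 1)) ^ 2

/-- Damped penalized minimum. -/
def hmin (q N : ℕ) (i : Fin r) (Z : Matrix (Fin r) (Fin ℓ) K) : ℝ≥0∞ :=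
  ENNReal.ofReal (kap N) * fmin q N i Z

/-- Limit of the damped penalized minima. -/
def hsup (q : ℕ) (i : Fin r) (Z : Matrix (Fin r) (Fin ℓ) K) : ℝ≥0∞ := ⨆ N, hmin q N i Z

lemma hmin_mono (q : ℕ) (i : Fin r) (Z : Matrix (Fin r) (Fin ℓ) K) :
    Monotone fun N => hmin q N i Z := by
  intro N N' h
  unfold hmin fmin
  refine mul_le_mul' (ENNReal.ofReal_le_ofReal ?_)
    (iInf_mono fun w => ENNReal.ofReal_le_ofReal ?_)
  · unfold kap
    gcongr
  · unfold fval
    gcongr with j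
    exact wt_mono q j h

instance matBorel [MeasurableSpace K] [BorelSpace K] {m n : Type*} [Fintype m] [Fintype n] :
    BorelSpace (Matrix m n K) :=
  inferInstanceAs (BorelSpace (m → n → K))

lemma hmin_meas [MeasurableSpace K] [BorelSpace K] (q N : ℕ) (i : Fin r) :
    Measurable (hmin q N i : Matrix (Fin r) (Fin ℓ) K → ℝ≥0∞) := by
  unfold hmin
  refine Measurable.const_mul ?_ _
  have : UpperSemicontinuous (fmin q N i : Matrix (Fin r) (Fin ℓ) K → ℝ≥0∞) := by
    unfold fmin
    refine upperSemicontinuous_iInf fun w => Continuous.upperSemicontinuous ?_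
    unfold fval
    refine ENNReal.continuous_ofReal.comp ?_
    refine continuous_finsetSum _ fun j _ => ?_
    have : Continuous fun Z : Matrix (Fin r) (Fin ℓ) K => (Z *ᵥ w) j :=
      (continuous_apply j).comp (Continuous.matrix_mulVec continuous_id continuous_const)
    fun_prop
  exact this.measurable

lemma hsup_meas [MeasurableSpace K] [BorelSpace K] (q : ℕ) (i : Fin r) :
    Measurable (hsup q i : Matrix (Fin r) (Fin ℓ) K → ℝ≥0∞) :=
  Measurable.iSup fun N => hmin_meas q N i

lemma cert_cs (q N : ℕ) (i : Fin r) (Z : Matrix (Fin r) (Fin ℓ) K)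
    (p : Fin r → K) (hp : Zᴴ *ᵥ p = 0) (w : Fin ℓ → K) :
    ‖p i‖ ^ 2 ≤ (∑ j, ‖p j‖ ^ 2 / wt q N j) * fval q N i (Z *ᵥ w) := by
  have h0 : star p ⬝ᵥ (Z *ᵥ w) = 0 := by
    have h1 : star p ᵥ* Z = 0 := by
      have := congrArg star hp
      rw [star_mulVec, conjTranspose_conjTranspose] at this
      simpa using this
    rw [dotProduct_mulVec, h1, zero_dotProduct]
  have h1 : star (p i) = ∑ j, star (p j) * ((Pi.single i 1 : Fin r → K) j - (Z *ᵥ w) j) := by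
    have : star p ⬝ᵥ ((Pi.single i 1 : Fin r → K) - Z *ᵥ w) = star (p i) := by
      rw [dotProduct_sub, h0, dotProduct_single]
      simp
    rw [← this]
    rfl
  have h2 : ‖p i‖ ≤ ∑ j, (‖p j‖ / Real.sqrt (wt q N j)) *
      (Real.sqrt (wt q N j) * ‖(Pi.single i 1 : Fin r → K) j - (Z *ᵥ w) j‖) := by
    rw [← norm_star (p i), h1]
    refine (norm_sum_le _ _).trans (Finset.sum_le_sum fun j _ => ?_)
    have := Real.sqrt_pos.mpr (wt_pos q N j)
    rw [norm_mul, norm_star]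
    apply le_of_eq
    field_simp
  calc ‖p i‖ ^ 2 ≤ _ := pow_le_pow_left₀ (norm_nonneg _) h2 2
    _ ≤ _ := Finset.sum_mul_sq_le_sq_mul_sq _ _ _
    _ = _ := by
      unfold fval
      congr 1
      · refine Finset.sum_congr rfl fun j _ => ?_
        rw [div_pow, Real.sq_sqrt (wt_pos q N j).le]
      · refine Finset.sum_congr rfl fun j _ => ?_
        rw [mul_pow, Real.sq_sqrt (wt_pos q N j).le]

lemma fval_nonneg (q N : ℕ) (i : Fin r) (z : Fin r → K) : 0 ≤ fval q N i z :=
  Finset.sum_nonneg fun j _ => mul_nonneg (wt_pos q N j).le (by positivity)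

lemma cert (q : ℕ) (i : Fin r) (Z : Matrix (Fin r) (Fin ℓ) K)
    (p : Fin r → K) (hp : Zᴴ *ᵥ p = 0) (hpi : p i ≠ 0) (x : ℝ)
    (hx : x * (∑ j : Fin r, if j.val < q then 0 else ‖p j‖ ^ 2) ≤ ‖p i‖ ^ 2) :
    ENNReal.ofReal x ≤ hsup q i Z := by
  refine le_of_forall_lt fun c hc => ?_
  obtain ⟨x₁, hcx, hx₁⟩ := exists_between hc
  have hx₁t : x₁ ≠ ⊤ := (hx₁.trans ENNReal.ofReal_lt_top).ne
  set y := x₁.toReal with hy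
  have hy0 : 0 ≤ y := ENNReal.toReal_nonneg
  have hyx : y < x := by
    have := (ENNReal.lt_ofReal_iff_toReal_lt hx₁t).mp hx₁
    exact this
  have hxy : x₁ = ENNReal.ofReal y := (ENNReal.ofReal_toReal hx₁t).symm
  set b := ∑ j : Fin r, if j.val < q then 0 else ‖p j‖ ^ 2 with hb
  set C := ∑ j : Fin r, if j.val < q then ‖p j‖ ^ 2 else 0 with hC
  have hb0 : 0 ≤ b := Finset.sum_nonneg fun j _ => by split_ifs <;> positivity
  have hC0 : 0 ≤ C := Finset.sum_nonneg fun j _ => by split_ifs <;> positivity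
  have hpp : 0 < ‖p i‖ ^ 2 := by
    have : 0 < ‖p i‖ := norm_pos_iff.mpr hpi
    positivity
  have hlt : 0 < ‖p i‖ ^ 2 - y * b := by
    rcases hb0.eq_or_lt with h | h
    · rw [← h]; simpa using hpp
    · have := mul_lt_mul_of_pos_right hyx h
      linarith
  have hsum : ∀ N : ℕ, ∑ j, ‖p j‖ ^ 2 / wt q N j = C * (1 / ((N:ℝ) + 1)) ^ 2 + b := by
    intro N
    rw [hC, hb, Finset.sum_mul, ← Finset.sum_add_distrib]
    refine Finset.sum_congr rfl fun j _ => ?_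
    unfold wt
    split_ifs
    · rw [add_zero, one_div, inv_pow, div_eq_mul_inv]
    · simp
  have hlim : Tendsto (fun N : ℕ => (1 - (1 / ((N:ℝ) + 1)) ^ 2) * ‖p i‖ ^ 2
      - y * (C * (1 / ((N:ℝ) + 1)) ^ 2 + b)) atTop
      (𝓝 ((1 - 0 ^ 2) * ‖p i‖ ^ 2 - y * (C * 0 ^ 2 + b))) := by
    have h := tendsto_one_div_add_atTop_nhds_zero_nat (𝕜 := ℝ)
    have h2 := h.pow 2
    exact ((tendsto_const_nhds.sub h2).mul_const _).sub
      (((h2.const_mul C).add_const b).const_mul y)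
  have hev := hlim.eventually_const_lt (u := 0) (by simpa using hlt)
  obtain ⟨N, hN⟩ := hev.exists
  set D := C * (1 / ((N:ℝ) + 1)) ^ 2 + b with hD
  have hD0 : 0 ≤ D := by positivity
  have hN' : y * D < kap N * ‖p i‖ ^ 2 := by unfold kap; linarith
  have hkap : 0 < kap N := by
    by_contra hcon
    have h1 : kap N * ‖p i‖ ^ 2 ≤ 0 := mul_nonpos_of_nonpos_of_nonneg (not_lt.mp hcon) hpp.le
    have h2 : 0 ≤ y * D := by positivity
    linarith
  have hmain : ENNReal.ofReal (y / kap N) ≤ fmin q N i Z := by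
    refine le_iInf fun w => ENNReal.ofReal_le_ofReal ?_
    have h1 := cert_cs q N i Z p hp w
    rw [hsum N, ← hD] at h1
    have hf := fval_nonneg q N i (Z *ᵥ w)
    have hDp : 0 < D := by
      rcases hD0.eq_or_lt with h | h
      · rw [← h, zero_mul] at h1; linarith
      · exact h
    rw [div_le_iff₀ hkap]
    have h3 : y * D ≤ (fval q N i (Z *ᵥ w) * kap N) * D := by nlinarith
    exact le_of_mul_le_mul_right h3 hDp
  calc c < ENNReal.ofReal y := hxy ▸ hcx
    _ = ENNReal.ofReal (kap N) * ENNReal.ofReal (y / kap N) := by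
      rw [← ENNReal.ofReal_mul hkap.le]; congr 1; field_simp
    _ ≤ hmin q N i Z := by unfold hmin; gcongr
    _ ≤ hsup q i Z := le_iSup (fun N => hmin q N i Z) N

end Objective

/-! ### The inner average over reflections -/

lemma beta_alpha (K : Type*) [RCLike K] : (Module.finrank ℝ K : ℝ) * (1 + alphaK K) = 2 := by
  unfold alphaK
  split_ifs with h
  · rw [(RCLike.realLinearIsometryEquiv h).toLinearEquiv.finrank_eq]
    norm_num
  · have h1 : RCLike.im (RCLike.I : K) = 1 := (RCLike.I_eq_zero_or_im_I_eq_one).resolve_left h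
    rw [(RCLike.complexLinearIsometryEquiv h1).toLinearEquiv.finrank_eq,
      Complex.finrank_real_complex]
    norm_num

lemma exists_sub_finrank {K V : Type*} [Field K] [AddCommGroup V] [Module K V]
    [FiniteDimensional K V] (S : Submodule K V) (t : ℕ) (ht : t ≤ Module.finrank K S) :
    ∃ T : Submodule K V, T ≤ S ∧ Module.finrank K T = t := by
  let b := Module.finBasis K S
  let v : Fin t → V := fun j => (b (Fin.castLE ht j) : V)
  have hv : LinearIndependent K v := by
    have h1 : LinearIndependent K (fun j => (b j : V)) :=
      b.linearIndependent.map' S.subtype S.ker_subtype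
    exact h1.comp _ (Fin.castLE_injective ht)
  refine ⟨Submodule.span K (Set.range v), ?_, ?_⟩
  · rw [Submodule.span_le]
    rintro _ ⟨j, rfl⟩
    exact (b _).2
  · rw [finrank_span_eq_card hv, Fintype.card_fin]

section Inner

variable {K : Type*} [RCLike K] {r ℓ : ℕ}

/-- The coordinates moved by the reflections. -/
abbrev JJ (r q : ℕ) (i : Fin r) : Type := {j : Fin r // j = i ∨ q ≤ j.val}

/-- Extension by zero. -/
def ext0 (q : ℕ) (i : Fin r) (g : EuclideanSpace K (JJ r q i)) : Fin r → K :=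
  fun j => if h : j = i ∨ q ≤ j.val then g ⟨j, h⟩ else 0

/-- Restriction. -/
def res0 (q : ℕ) (i : Fin r) : (Fin r → K) →ₗ[K] EuclideanSpace K (JJ r q i) where
  toFun p := WithLp.toLp 2 fun j => p j.1
  map_add' _ _ := rfl
  map_smul' _ _ := rfl

lemma card_JJ (q : ℕ) (i : Fin r) (hi : i.val < q) (hqr : q ≤ r) :
    Fintype.card (JJ r q i) = r - q + 1 := by
  rw [Fintype.card_subtype]
  have : (Finset.univ.filter fun j : Fin r => j = i ∨ q ≤ j.val) =
      insert i (Finset.univ.filter fun j : Fin r => q ≤ j.val) := by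
    ext j; simp
  rw [this, Finset.card_insert_of_notMem (by simp [hi])]
  congr 1
  have h := Finset.card_filter_add_card_filter_not (s := (Finset.univ : Finset (Fin r)))
    (fun j : Fin r => j.val < q)
  simp only [Fin.card_filter_val_lt, not_lt, Finset.card_univ, Fintype.card_fin] at h
  omega

lemma sum_JJ (q : ℕ) (i : Fin r) (f : Fin r → ℝ) :
    ∑ j : JJ r q i, f j.1 = ∑ j, if j = i ∨ q ≤ j.val then f j else 0 := by
  rw [← Finset.sum_filter]
  exact (Finset.sum_subtype _ (by simp) f).symm

lemma sum_JJ_split (q : ℕ) (i : Fin r) (hi : i.val < q) (f : Fin r → ℝ) :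
    ∑ j : JJ r q i, f j.1 = f i + ∑ j : Fin r, if j.val < q then 0 else f j := by
  rw [sum_JJ]
  have : f i = ∑ j : Fin r, if j = i then f j else 0 := by simp
  rw [this, ← Finset.sum_add_distrib]
  refine Finset.sum_congr rfl fun j _ => ?_
  by_cases hj : j = i
  · subst hj; simp [hi]
  · by_cases h2 : j.val < q
    · simp [hj, h2, not_le.mpr h2]
    · simp [hj, h2, not_lt.mp h2]

lemma nsq_ext0 (q : ℕ) (i : Fin r) (g : EuclideanSpace K (JJ r q i)) :
    nsq (ext0 q i g) = ‖g‖ ^ 2 := by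
  rw [EuclideanSpace.norm_sq_eq]
  have : ∀ j : JJ r q i, ‖g j‖ ^ 2 = (fun j' => ‖ext0 q i g j'‖ ^ 2) j.1 := by
    intro j
    simp [ext0, j.2]
  rw [Finset.sum_congr rfl fun j _ => this j, sum_JJ q i fun j' => ‖ext0 q i g j'‖ ^ 2]
  refine Finset.sum_congr rfl fun j _ => ?_
  split_ifs with h
  · rfl
  · simp [ext0, h]

lemma dot_ext0 (q : ℕ) (i : Fin r) (g : EuclideanSpace K (JJ r q i)) (p : Fin r → K) :
    inner ℝ g (res0 q i p) = RCLike.re (star (ext0 q i g) ⬝ᵥ p) := by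
  rw [PiLp.inner_apply, dotProduct, map_sum]
  have : ∀ j : JJ r q i, inner ℝ (g j) (res0 q i p j) =
      (fun j' => RCLike.re (star (ext0 q i g) j' * p j')) j.1 := by
    intro j
    simp only [ext0, j.2, res0, Pi.star_apply, dif_pos]
    simp only [RCLike.star_def]
    rw [real_inner_eq_re_inner K, RCLike.inner_apply, mul_comm]
    rfl
  rw [Finset.sum_congr rfl fun j _ => this j,
    sum_JJ q i fun j' => RCLike.re (star (ext0 q i g) j' * p j')]
  refine Finset.sum_congr rfl fun j _ => ?_
  split_ifs with h
  · rfl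
  · simp [ext0, h]

lemma nsq_unitary (R : Matrix (Fin r) (Fin r) K) (hR : R ∈ Matrix.unitaryGroup (Fin r) K)
    (p : Fin r → K) : nsq (R *ᵥ p) = nsq p := by
  have h : ((nsq (R *ᵥ p) : ℝ) : K) = ((nsq p : ℝ) : K) := by
    rw [← star_dot_self, ← star_dot_self, star_mulVec, dotProduct_mulVec, vecMul_vecMul]
    rw [Matrix.mem_unitaryGroup_iff', star_eq_conjTranspose] at hR
    rw [hR, vecMul_one]
  exact_mod_cast h

lemma inner_point (q : ℕ) (i : Fin r) (hi : i.val < q) (Z : Matrix (Fin r) (Fin ℓ) K)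
    (p : Fin r → K) (hp : Zᴴ *ᵥ p = 0) (g : EuclideanSpace K (JJ r q i))
    (S : Submodule ℝ (EuclideanSpace K (JJ r q i)))
    (hpg : res0 q i p = (S.orthogonalProjectionOnto g : EuclideanSpace K (JJ r q i))) :
    ENNReal.ofReal (‖S.orthogonalProjectionOnto g‖ ^ 2 * (‖Sᗮ.orthogonalProjectionOnto g‖ ^ 2)⁻¹) ≤
      hsup q i (hhm i (ext0 q i g) * Z) := by
  set R := hhm i (ext0 q i g) with hRdef
  have hR : R ∈ Matrix.unitaryGroup (Fin r) K := hhm_unitary _ _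
  set a := ‖S.orthogonalProjectionOnto g‖ with ha
  set b := ‖Sᗮ.orthogonalProjectionOnto g‖ with hb
  have hab : ‖g‖ ^ 2 = a ^ 2 + b ^ 2 := S.norm_sq_eq_add_norm_sq_projection g
  have hin : inner ℝ g (res0 q i p) = a ^ 2 := by
    rw [hpg]
    have := S.inner_orthogonalProjectionOnto_eq_of_mem_left (S.orthogonalProjectionOnto g) g
    rw [real_inner_comm, ← this, real_inner_self_eq_norm_sq]
  have h1 : a ^ 2 ≤ ‖g‖ * ‖(R *ᵥ p) i‖ := by
    have h := hhm_at i (ext0 q i g) p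
    rw [nsq_ext0, Real.sqrt_sq (norm_nonneg _)] at h
    rw [h, ← hin, dot_ext0]
    exact RCLike.re_le_norm _
  have hpa : ∑ j : JJ r q i, ‖p j.1‖ ^ 2 = a ^ 2 := by
    have : a ^ 2 = ‖res0 q i p‖ ^ 2 := by rw [hpg]; rfl
    rw [this, EuclideanSpace.norm_sq_eq]
    rfl
  have hRa : ∑ j : JJ r q i, ‖(R *ᵥ p) j.1‖ ^ 2 = a ^ 2 := by
    rw [← hpa, sum_JJ q i fun j => ‖(R *ᵥ p) j‖ ^ 2, sum_JJ q i fun j => ‖p j‖ ^ 2]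
    have h2 := nsq_unitary R hR p
    have hsplit : ∀ u : Fin r → K, nsq u = (∑ j, if j = i ∨ q ≤ j.val then ‖u j‖ ^ 2 else 0) +
        ∑ j, if j = i ∨ q ≤ j.val then 0 else ‖u j‖ ^ 2 := by
      intro u
      rw [← Finset.sum_add_distrib, nsq]
      refine Finset.sum_congr rfl fun j _ => ?_
      split_ifs <;> simp
    rw [hsplit, hsplit] at h2
    have h3 : (∑ j, if j = i ∨ q ≤ j.val then 0 else ‖(R *ᵥ p) j‖ ^ 2) =
        ∑ j, if j = i ∨ q ≤ j.val then 0 else ‖p j‖ ^ 2 := by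
      refine Finset.sum_congr rfl fun j _ => ?_
      split_ifs with h
      · rfl
      · rw [hRdef, hhm_off i _ p j (fun hj => h (Or.inl hj)) (by simp [ext0, h])]
    linarith
  rw [sum_JJ_split q i hi fun j => ‖(R *ᵥ p) j‖ ^ 2] at hRa
  rcases eq_or_ne a 0 with ha0 | ha0
  · simp [ha0]
  rcases eq_or_ne b 0 with hb0 | hb0
  · simp [hb0]
  have hap : 0 < a := lt_of_le_of_ne (norm_nonneg _) ha0.symm
  have hbp : 0 < b := lt_of_le_of_ne (norm_nonneg _) hb0.symm
  refine cert q i (R * Z) (R *ᵥ p) ?_ ?_ _ ?_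
  · rw [conjTranspose_mul, mulVec_mulVec, Matrix.mul_assoc]
    rw [Matrix.mem_unitaryGroup_iff', star_eq_conjTranspose] at hR
    rw [hR, Matrix.mul_one, hp]
  · intro h0
    rw [h0, norm_zero, mul_zero] at h1
    nlinarith
  · set t := ‖(R *ᵥ p) i‖ with ht
    have hBt : (∑ j : Fin r, if j.val < q then 0 else ‖(R *ᵥ p) j‖ ^ 2) = a ^ 2 - t ^ 2 := by
      linarith
    rw [hBt]
    have h4 : (a ^ 2) ^ 2 ≤ (a ^ 2 + b ^ 2) * t ^ 2 := by
      rw [← hab, ← mul_pow]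
      exact pow_le_pow_left₀ (by positivity) h1 2
    rw [mul_comm (a ^ 2), mul_assoc, inv_mul_le_iff₀ (by positivity)]
    nlinarith

variable [MeasurableSpace K] [BorelSpace K]

lemma inner_avg (q : ℕ) (i : Fin r) (hi : i.val < q) (hq : (q : ℝ) + alphaK K < (ℓ : ℝ))
    (hqℓ : q ≤ ℓ) (hℓr : ℓ ≤ r) (Z : Matrix (Fin r) (Fin ℓ) K)
    (hnd : ∀ p : Fin r → K, Zᴴ *ᵥ p = 0 → (∀ j, (j = i ∨ q ≤ j.val) → p j = 0) → p = 0) :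
    ENNReal.ofReal (((r : ℝ) - ℓ) / ((ℓ : ℝ) - q - alphaK K)) *
      ∫⁻ g : EuclideanSpace K (JJ r q i), gw g ≤
    ∫⁻ g : EuclideanSpace K (JJ r q i), hsup q i (hhm i (ext0 q i g) * Z) * gw g := by
  let L : Submodule K (Fin r → K) := LinearMap.ker (Zᴴ).mulVecLin
  have hL : r - ℓ ≤ Module.finrank K L := by
    have h1 := LinearMap.finrank_range_add_finrank_ker (Zᴴ).mulVecLin
    have h2 := Submodule.finrank_le (LinearMap.range (Zᴴ).mulVecLin)
    simp only [Module.finrank_fintype_fun_eq_card, Fintype.card_fin] at h1 h2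
    change _ + Module.finrank K L = r at h1
    omega
  let f : L →ₗ[K] EuclideanSpace K (JJ r q i) := (res0 q i).comp L.subtype
  have hf : Function.Injective f := by
    rw [← LinearMap.ker_eq_bot, LinearMap.ker_eq_bot']
    intro p hp
    have hp1 : Zᴴ *ᵥ p.1 = 0 := p.2
    refine Subtype.ext (hnd p.1 hp1 fun j hj => ?_)
    exact congrFun (congrArg WithLp.ofLp hp) ⟨j, hj⟩
  obtain ⟨T, hTS, hT⟩ := exists_sub_finrank (LinearMap.range f) (r - ℓ)
    (by rw [LinearMap.finrank_range_of_inj hf]; exact hL)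
  let S : Submodule ℝ (EuclideanSpace K (JJ r q i)) := T.restrictScalars ℝ
  have hβ := beta_alpha K
  set β := Module.finrank ℝ K with hβdef
  have hS : Module.finrank ℝ S = β * (r - ℓ) := by
    rw [← hT]
    exact (Module.finrank_mul_finrank ℝ K T).symm
  have hG : Module.finrank ℝ (EuclideanSpace K (JJ r q i)) = β * (r - q + 1) := by
    rw [← Module.finrank_mul_finrank ℝ K, finrank_euclideanSpace,
      card_JJ q i hi (hqℓ.trans hℓr)]
  have hSo : Module.finrank ℝ Sᗮ = β * (ℓ - q + 1) := by
    have h := S.finrank_add_finrank_orthogonal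
    rw [hS, hG] at h
    have : r - q + 1 = (r - ℓ) + (ℓ - q + 1) := by omega
    rw [this, mul_add] at h
    omega
  have hSoR : (Module.finrank ℝ Sᗮ : ℝ) - 2 = β * ((ℓ : ℝ) - q - alphaK K) := by
    rw [hSo]; push_cast [Nat.cast_sub hqℓ]; linear_combination hβ
  have hβ0 : 0 < (β : ℝ) := by
    rcases Nat.eq_zero_or_pos β with h | h
    · rw [h] at hβ; norm_num at hβ
    · exact_mod_cast h
  have h2 : 2 < Module.finrank ℝ Sᗮ := by
    have : (0:ℝ) < (Module.finrank ℝ Sᗮ : ℝ) - 2 := by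
      rw [hSoR]; exact mul_pos hβ0 (by linarith)
    have : (2:ℝ) < (Module.finrank ℝ Sᗮ : ℝ) := by linarith
    exact_mod_cast this
  have key := gauss_ratio S h2
  have hc : ((r : ℝ) - ℓ) / ((ℓ : ℝ) - q - alphaK K) =
      (Module.finrank ℝ S : ℝ) / ((Module.finrank ℝ Sᗮ : ℝ) - 2) := by
    rw [hSoR, hS]; push_cast [Nat.cast_sub hℓr]
    rw [mul_div_mul_left _ _ hβ0.ne']
  rw [hc, ← key]
  refine lintegral_mono fun g => ?_
  gcongr
  obtain ⟨p, hp⟩ : (S.orthogonalProjectionOnto g : EuclideanSpace K (JJ r q i)) ∈ LinearMap.range f :=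
    hTS (S.orthogonalProjectionOnto g).2
  exact inner_point q i hi Z p.1 p.2 g S hp

end Inner

/-! ### Haar averaging over the unitary group -/

section Haar

variable {K : Type*} [RCLike K] {r ℓ : ℕ}

instance matSecondCountable {m n : Type*} [Fintype m] [Fintype n] :
    SecondCountableTopology (Matrix m n K) :=
  inferInstanceAs (SecondCountableTopology (m → n → K))

instance unitaryCompact : CompactSpace (Matrix.unitaryGroup (Fin r) K) := by
  suffices h : IsCompact (Matrix.unitaryGroup (Fin r) K : Set (Matrix (Fin r) (Fin r) K)) from
    isCompact_iff_compactSpace.mp h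
  have hc : IsCompact (Set.pi Set.univ fun _ : Fin r => Set.pi Set.univ fun _ : Fin r =>
      Metric.closedBall (0 : K) 1) :=
    isCompact_univ_pi fun _ => isCompact_univ_pi fun _ => isCompact_closedBall _ _
  refine hc.of_isClosed_subset (isClosed_unitary (R := Matrix (Fin r) (Fin r) K)) ?_
  intro U hU a _ b _
  simpa using entry_norm_bound_of_unitary hU a b

variable [MeasurableSpace K] [BorelSpace K]

/-- Normalized Haar measure on the unitary group. -/
def nuH (r : ℕ) (K : Type*) [RCLike K] [MeasurableSpace K] [BorelSpace K] :
    Measure (Matrix.unitaryGroup (Fin r) K) :=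
  Measure.haarMeasure ⊤

instance nuH_prob : IsProbabilityMeasure (nuH r K) := ⟨by
  unfold nuH
  have := Measure.haarMeasure_self (K₀ := (⊤ : TopologicalSpace.PositiveCompacts (Matrix.unitaryGroup (Fin r) K)))
  simpa using this⟩

instance nuH_inv : (nuH r K).IsMulLeftInvariant := by
  unfold nuH; infer_instance

lemma ext0_meas (q : ℕ) (i : Fin r) : Measurable (ext0 (K := K) q i) := by
  rw [measurable_pi_iff]
  intro j
  unfold ext0
  by_cases h : j = i ∨ q ≤ j.val
  · simp only [h, dif_pos]
    fun_prop
  · simp only [h, dif_neg, not_false_eq_true]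
    fun_prop

lemma haar_step (q : ℕ) (i : Fin r) (hi : i.val < q) (hq : (q : ℝ) + alphaK K < (ℓ : ℝ))
    (hqℓ : q ≤ ℓ) (hℓr : ℓ ≤ r) (W : Matrix (Fin r) (Fin ℓ) K)
    (hnd : ∀ᵐ V ∂(nuH r K), ∀ p : Fin r → K, (V.1 * W)ᴴ *ᵥ p = 0 →
      (∀ j, (j = i ∨ q ≤ j.val) → p j = 0) → p = 0) :
    ENNReal.ofReal (((r : ℝ) - ℓ) / ((ℓ : ℝ) - q - alphaK K)) ≤
      ∫⁻ V, hsup q i (V.1 * W) ∂(nuH r K) := by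
  have hG : Nontrivial (EuclideanSpace K (JJ r q i)) := by
    have : Nonempty (JJ r q i) := ⟨⟨i, Or.inl rfl⟩⟩
    refine Module.nontrivial_of_finrank_pos (R := K) ?_
    rw [finrank_euclideanSpace]
    exact Fintype.card_pos
  obtain ⟨hΓ0, hΓt⟩ := gauss_mass_ne (E := EuclideanSpace K (JJ r q i))
  set Γ := ∫⁻ g : EuclideanSpace K (JJ r q i), gw g with hΓ
  let RU : EuclideanSpace K (JJ r q i) → Matrix.unitaryGroup (Fin r) K :=
    fun g => ⟨hhm i (ext0 q i g), hhm_unitary _ _⟩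
  have hmR : Measurable fun g : EuclideanSpace K (JJ r q i) => hhm i (ext0 q i g) :=
    (hhm_meas i).comp (ext0_meas q i)
  have hinv : ∀ g, ∫⁻ V, hsup q i (hhm i (ext0 q i g) * (V.1 * W)) ∂(nuH r K) =
      ∫⁻ V, hsup q i (V.1 * W) ∂(nuH r K) := by
    intro g
    have := lintegral_mul_left_eq_self (μ := nuH r K) (fun V => hsup q i (V.1 * W)) (RU g)
    rw [← this]
    refine lintegral_congr fun V => ?_
    change _ = hsup q i ((hhm i (ext0 q i g) * V.1) * W)
    rw [Matrix.mul_assoc]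
    rfl
  have hmeas : Measurable fun x : EuclideanSpace K (JJ r q i) × Matrix.unitaryGroup (Fin r) K =>
      hsup q i (hhm i (ext0 q i x.1) * (x.2.1 * W)) * gw x.1 := by
    refine Measurable.mul ?_ (gw_meas.comp measurable_fst)
    refine (hsup_meas q i).comp ?_
    have h1 : Measurable fun x : EuclideanSpace K (JJ r q i) × Matrix.unitaryGroup (Fin r) K =>
      (hhm i (ext0 q i x.1), x.2.1) :=
      (hmR.comp measurable_fst).prodMk (measurable_subtype_coe.comp measurable_snd)
    have h2 : Continuous fun y : Matrix (Fin r) (Fin r) K × Matrix (Fin r) (Fin r) K =>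
      y.1 * (y.2 * W) := continuous_fst.matrix_mul (continuous_snd.matrix_mul continuous_const)
    exact h2.measurable.comp h1
  have h1 : (∫⁻ V, hsup q i (V.1 * W) ∂(nuH r K)) * Γ =
      ∫⁻ V : Matrix.unitaryGroup (Fin r) K, (∫⁻ g : EuclideanSpace K (JJ r q i),
        hsup q i (hhm i (ext0 q i g) * (V.1 * W)) * gw g) ∂(nuH r K) := by
    have hsw := lintegral_lintegral_swap (μ := (volume : Measure (EuclideanSpace K (JJ r q i))))
      (ν := nuH r K) (f := fun g V => hsup q i (hhm i (ext0 q i g) * (V.1 * W)) * gw g)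
      hmeas.aemeasurable
    refine Eq.trans ?_ hsw
    rw [hΓ, ← lintegral_const_mul _ gw_meas]
    refine lintegral_congr fun g => ?_
    rw [← hinv g, lintegral_mul_const'' ]
    · rfl
    have hc : Continuous fun V : Matrix.unitaryGroup (Fin r) K => hhm i (ext0 q i g) * (V.1 * W) :=
      continuous_const.matrix_mul (continuous_subtype_val.matrix_mul continuous_const)
    exact ((hsup_meas q i).comp hc.measurable).aemeasurable
  have h2 : ENNReal.ofReal (((r : ℝ) - ℓ) / ((ℓ : ℝ) - q - alphaK K)) * Γ ≤
      (∫⁻ V, hsup q i (V.1 * W) ∂(nuH r K)) * Γ := by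
    rw [h1]
    calc _ = ∫⁻ V, ENNReal.ofReal (((r : ℝ) - ℓ) / ((ℓ : ℝ) - q - alphaK K)) * Γ ∂(nuH r K) := by
          simp
      _ ≤ _ := lintegral_mono_ae (hnd.mono fun V hV => inner_avg q i hi hq hqℓ hℓr _ hV)
  exact (ENNReal.mul_le_mul_iff_left hΓ0 hΓt).mp h2

lemma haar_total (q : ℕ) (hq : (q : ℝ) + alphaK K < (ℓ : ℝ))
    (hqℓ : q ≤ ℓ) (hℓr : ℓ ≤ r) (W : Matrix (Fin r) (Fin ℓ) K) :
    ENNReal.ofReal ((q : ℝ) * (((r : ℝ) - ℓ) / ((ℓ : ℝ) - q - alphaK K))) ≤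
      ∑ i ∈ Finset.univ.filter (fun i : Fin r => i.val < q),
        ∫⁻ V, hsup q i (V.1 * W) ∂(nuH r K) := by
  set I := Finset.univ.filter (fun i : Fin r => i.val < q) with hI
  by_cases htop : ∑ i ∈ I, ∫⁻ V, hsup q i (V.1 * W) ∂(nuH r K) = ⊤
  · rw [htop]; exact le_top
  have hfin : ∀ i ∈ I, ∫⁻ V, hsup q i (V.1 * W) ∂(nuH r K) ≠ ⊤ := fun i hi =>
    ENNReal.sum_ne_top.mp htop i hi
  have hmeas : ∀ i, Measurable fun V : Matrix.unitaryGroup (Fin r) K => hsup q i (V.1 * W) := by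
    intro i
    have hc : Continuous fun V : Matrix.unitaryGroup (Fin r) K => V.1 * W :=
      continuous_subtype_val.matrix_mul continuous_const
    exact (hsup_meas q i).comp hc.measurable
  have hae : ∀ᵐ V ∂(nuH r K), ∀ i ∈ I, hsup q i (V.1 * W) < ⊤ := by
    rw [ae_all_iff]
    intro i
    by_cases hi : i ∈ I
    · filter_upwards [ae_lt_top (hmeas i) (hfin i hi)] with V hV _ using hV
    · exact Eventually.of_forall fun V h => absurd h hi
  have hstep : ∀ i ∈ I, ENNReal.ofReal (((r : ℝ) - ℓ) / ((ℓ : ℝ) - q - alphaK K)) ≤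
      ∫⁻ V, hsup q i (V.1 * W) ∂(nuH r K) := by
    intro i hi
    refine haar_step q i (by simpa [hI] using hi) hq hqℓ hℓr W ?_
    filter_upwards [hae] with V hV p hp hp0
    by_contra hne
    obtain ⟨j, hj⟩ : ∃ j, p j ≠ 0 := by
      by_contra hcon
      push Not at hcon
      exact hne (funext hcon)
    have hjq : j.val < q := by
      by_contra hcon
      exact hj (hp0 j (Or.inr (not_lt.mp hcon)))
    have hlt := hV j (by simp [hI, hjq])
    have hle := cert q j (V.1 * W) p hp hj ((hsup q j (V.1 * W)).toReal + 1) (by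
      have : (∑ j : Fin r, if j.val < q then 0 else ‖p j‖ ^ 2) = 0 := by
        refine Finset.sum_eq_zero fun j' _ => ?_
        split_ifs with h
        · rfl
        · rw [hp0 j' (Or.inr (not_lt.mp h))]; simp
      rw [this, mul_zero]
      positivity)
    rw [ENNReal.ofReal_le_iff_le_toReal hlt.ne] at hle
    linarith
  have hcard : I.card = q := by
    rw [hI, Fin.card_filter_val_lt]
    exact min_eq_right (hqℓ.trans hℓr)
  calc _ = ∑ i ∈ I, ENNReal.ofReal (((r : ℝ) - ℓ) / ((ℓ : ℝ) - q - alphaK K)) := by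
        rw [Finset.sum_const, hcard, nsmul_eq_mul, ENNReal.ofReal_mul (by positivity)]
        simp
    _ ≤ _ := Finset.sum_le_sum hstep

end Haar

/-! ### Linear algebra -/

section LinAlg

variable {K : Type*} [RCLike K]

lemma frobSq_nonneg {m n : Type*} [Fintype m] [Fintype n] (A : Matrix m n K) : 0 ≤ frobSq A := by
  unfold frobSq; positivity

lemma frobSq_trace {m n : Type*} [Fintype m] [Fintype n] (A : Matrix m n K) :
    (frobSq A : K) = (A * Aᴴ).trace := by
  simp only [frobSq, Matrix.trace, Matrix.diag, Matrix.mul_apply, Matrix.conjTranspose_apply]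
  push_cast
  refine Finset.sum_congr rfl fun i _ => Finset.sum_congr rfl fun j _ => ?_
  rw [← starRingEnd_apply, RCLike.mul_conj]

lemma frobSq_mul_coisom {m n k : Type*} [Fintype m] [Fintype n] [Fintype k] [DecidableEq n]
    (X : Matrix m n K) (U : Matrix n k K) (hU : U * Uᴴ = 1) : frobSq (X * U) = frobSq X := by
  have : (frobSq (X * U) : K) = (frobSq X : K) := by
    rw [frobSq_trace, frobSq_trace, conjTranspose_mul, Matrix.mul_assoc, ← Matrix.mul_assoc U,
      hU, Matrix.one_mul]
  exact_mod_cast this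

lemma proj_col {m : Type*} [Fintype m] (P : Matrix m m K) (h1 : Pᴴ = P) (h2 : P * P = P) (a : m) :
    ∑ b, ‖P b a‖ ^ 2 = RCLike.re (P a a) := by
  have : ((∑ b, ‖P b a‖ ^ 2 : ℝ) : K) = P a a := by
    conv_rhs => rw [← h2]
    rw [Matrix.mul_apply]
    push_cast
    refine Finset.sum_congr rfl fun b _ => ?_
    have : P a b = star (P b a) := by
      conv_lhs => rw [← h1]
      rfl
    rw [this, ← starRingEnd_apply, RCLike.conj_mul]
  rw [← this, RCLike.ofReal_re]

lemma proj_compl {m : Type*} [Fintype m] [DecidableEq m] (P : Matrix m m K) (h1 : Pᴴ = P)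
    (h2 : P * P = P) (a : m) :
    ∑ b, ‖(1 - P) b a‖ ^ 2 = 1 - RCLike.re (P a a) := by
  rw [proj_col (1 - P)]
  · simp
  · simp [h1]
  · simp [Matrix.mul_sub, Matrix.sub_mul, h2]

lemma trace_rank {m : ℕ} (P : Matrix (Fin m) (Fin m) K) (h2 : P * P = P) :
    P.trace = (P.rank : K) := by
  have h : IsIdempotentElem (Matrix.toLin' P) := by
    unfold IsIdempotentElem
    rw [Module.End.mul_eq_comp, ← Matrix.toLin'_mul, h2]
  have := (LinearMap.IsIdempotentElem.isProj_range _ h).trace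
  rw [Matrix.trace_toLin'_eq] at this
  rw [this]
  rfl

/-- Isometric coordinate embedding. -/
def emb (K : Type*) [RCLike K] {r d : ℕ} (h : r ≤ d) : Matrix (Fin d) (Fin r) K :=
  (1 : Matrix (Fin d) (Fin d) K).submatrix id (Fin.castLE h)

lemma emb_isom {r d : ℕ} (h : r ≤ d) : (emb K h)ᴴ * emb K h = 1 := by
  unfold emb
  rw [conjTranspose_submatrix, conjTranspose_one, Matrix.submatrix_mul _ _ _ id _ Function.bijective_id |>.symm,
    Matrix.one_mul]
  exact Matrix.submatrix_one _ (Fin.castLE_injective h)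

lemma mul_emb_apply {r d : ℕ} (h : r ≤ d) {m : Type*} (X : Matrix m (Fin d) K) (a : m) (j : Fin r) :
    (X * emb K h) a j = X a (Fin.castLE h j) := by
  simp [emb, Matrix.mul_apply, Matrix.one_apply]

lemma frobSq_emb_mul {r d : ℕ} (h : r ≤ d) {n : Type*} [Fintype n] (X : Matrix (Fin r) n K) :
    frobSq (emb K h * X) = frobSq X := by
  have : (frobSq (emb K h * X) : K) = (frobSq X : K) := by
    rw [frobSq_trace, frobSq_trace, conjTranspose_mul, Matrix.mul_assoc, Matrix.trace_mul_comm,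
      ← Matrix.mul_assoc, Matrix.mul_assoc, emb_isom, Matrix.mul_one]
  exact_mod_cast this

/-- Singular values. -/
def sv {r : ℕ} (q N : ℕ) (j : Fin r) : ℝ := if j.val < q then (N : ℝ) + 1 else 1

lemma sv_sq {r : ℕ} (q N : ℕ) (j : Fin r) : sv q N j ^ 2 = wt q N j := by
  unfold sv wt; split_ifs <;> simp

lemma sv_pos {r : ℕ} (q N : ℕ) (j : Fin r) : 0 < sv q N j := by
  unfold sv; split_ifs <;> positivity

/-- Diagonal matrix of singular values. -/
def DD (K : Type*) [RCLike K] (r q N : ℕ) : Matrix (Fin r) (Fin r) K :=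
  Matrix.diagonal fun j => ((sv q N j : ℝ) : K)

/-- Truncated diagonal matrix of singular values. -/
def DT (K : Type*) [RCLike K] (r q N : ℕ) : Matrix (Fin r) (Fin r) K :=
  Matrix.diagonal fun j => if j.val < q then ((sv q N j : ℝ) : K) else 0

/-- The hard instance. -/
def Ahard {r d n : ℕ} (hrd : r ≤ d) (hrn : r ≤ n) (D V : Matrix (Fin r) (Fin r) K) :
    Matrix (Fin d) (Fin n) K := emb K hrd * D * (V * (emb K hrn)ᴴ)

variable {r d n : ℕ} (hrd : r ≤ d) (hrn : r ≤ n) (V : Matrix (Fin r) (Fin r) K)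

lemma coisom (hV : V ∈ Matrix.unitaryGroup (Fin r) K) : (V * (emb K hrn)ᴴ) * (V * (emb K hrn)ᴴ)ᴴ = 1 := by
  rw [conjTranspose_mul, conjTranspose_conjTranspose, Matrix.mul_assoc,
    ← Matrix.mul_assoc (emb K hrn)ᴴ, emb_isom, Matrix.one_mul]
  exact (Matrix.mem_unitaryGroup_iff.mp hV)

lemma Ahard_rank (hV : V ∈ Matrix.unitaryGroup (Fin r) K) (q N : ℕ) : (Ahard hrd hrn (DD K r q N) V).rank = r := by
  have hD : (DD K r q N).rank = r := by
    classical
    unfold DD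
    rw [rank_diagonal]
    simp [fun j : Fin r => (sv_pos q N j).ne']
  apply le_antisymm
  · calc _ ≤ _ := rank_mul_le_left _ _
      _ ≤ _ := rank_mul_le_right _ _
      _ = r := hD
  · have : DD K r q N = (emb K hrd)ᴴ * (Ahard hrd hrn (DD K r q N) V * (V * (emb K hrn)ᴴ)ᴴ) := by
      unfold Ahard
      rw [Matrix.mul_assoc _ _ (_)ᴴ, coisom hrn V hV, Matrix.mul_one, ← Matrix.mul_assoc, emb_isom,
        Matrix.one_mul]
    calc r = (DD K r q N).rank := hD.symm
      _ ≤ _ := by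
        conv_lhs => rw [this]
        exact (rank_mul_le_right _ _).trans (rank_mul_le_left _ _)

lemma emb_diag_col {D : Fin r → ℝ} (X : Matrix (Fin d) (Fin d) K) (j : Fin r) :
    ∑ b, ‖(X * (emb K hrd * Matrix.diagonal fun j => ((D j : ℝ) : K))) b j‖ ^ 2
      = D j ^ 2 * ∑ b, ‖X b (Fin.castLE hrd j)‖ ^ 2 := by
  rw [Finset.mul_sum]
  refine Finset.sum_congr rfl fun b _ => ?_
  rw [← Matrix.mul_assoc, Matrix.mul_diagonal, mul_emb_apply, norm_mul, mul_pow, RCLike.norm_ofReal,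
    sq_abs, mul_comm]

lemma frobSq_cols {m n : Type*} [Fintype m] [Fintype n] (A : Matrix m n K) :
    frobSq A = ∑ j, ∑ i, ‖A i j‖ ^ 2 := by
  unfold frobSq; exact Finset.sum_comm

lemma num_eq (hV : V ∈ Matrix.unitaryGroup (Fin r) K)
    (q N : ℕ) (P : Matrix (Fin d) (Fin d) K) (h1 : Pᴴ = P) (h2 : P * P = P) :
    frobSq ((1 - P) * Ahard hrd hrn (DD K r q N) V) =
      ∑ j : Fin r, wt q N j * (1 - RCLike.re (P (Fin.castLE hrd j) (Fin.castLE hrd j))) := by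
  unfold Ahard
  rw [← Matrix.mul_assoc, frobSq_mul_coisom _ _ (coisom hrn V hV), frobSq_cols]
  refine Finset.sum_congr rfl fun j _ => ?_
  unfold DD
  rw [emb_diag_col, proj_compl P h1 h2, sv_sq]

lemma sum_proj_le (P : Matrix (Fin d) (Fin d) K) (h1 : Pᴴ = P) (h2 : P * P = P) (k : ℕ)
    (hk : P.rank ≤ k) :
    (r : ℝ) - k ≤ ∑ j : Fin r, (1 - RCLike.re (P (Fin.castLE hrd j) (Fin.castLE hrd j))) := by
  have h3 : ∑ a, RCLike.re (P a a) = (P.rank : ℝ) := by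
    have := congrArg RCLike.re (trace_rank P h2)
    simpa [Matrix.trace] using this
  have h4 : ∑ j : Fin r, RCLike.re (P (Fin.castLE hrd j) (Fin.castLE hrd j)) ≤
      ∑ a, RCLike.re (P a a) := by
    rw [← Finset.sum_image (s := Finset.univ) (g := Fin.castLE hrd) (f := fun a => RCLike.re (P a a))
      (fun x _ y _ h => Fin.castLE_injective hrd h)]
    refine Finset.sum_le_sum_of_subset_of_nonneg (Finset.subset_univ _) fun a _ _ => ?_
    rw [← proj_col P h1 h2]
    positivity
  have h5 : (P.rank : ℝ) ≤ k := by exact_mod_cast hk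
  simp only [Finset.sum_sub_distrib, Finset.sum_const, Finset.card_univ, Fintype.card_fin,
    nsmul_eq_mul, mul_one]
  linarith

lemma one_le_wt (q N : ℕ) (j : Fin r) : 1 ≤ wt q N j := by
  unfold wt; split_ifs
  · nlinarith [(Nat.cast_nonneg N : (0 : ℝ) ≤ N)]
  · exact le_rfl

lemma compl_nonneg (P : Matrix (Fin d) (Fin d) K) (h1 : Pᴴ = P) (h2 : P * P = P) (a : Fin d) :
    0 ≤ 1 - RCLike.re (P a a) := by
  rw [← proj_compl P h1 h2]; positivity

lemma frobSq_diff (hqr : q ≤ r) (hV : V ∈ Matrix.unitaryGroup (Fin r) K) (N : ℕ) :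
    frobSq (Ahard hrd hrn (DD K r q N) V - Ahard hrd hrn (DT K r q N) V) = (r : ℝ) - q := by
  unfold Ahard
  rw [← Matrix.sub_mul, ← Matrix.mul_sub, frobSq_mul_coisom _ _ (coisom hrn V hV), frobSq_emb_mul]
  have : DD K r q N - DT K r q N = Matrix.diagonal fun j => if j.val < q then 0 else 1 := by
    unfold DD DT
    rw [Matrix.diagonal_sub]
    congr 1
    funext j
    unfold sv
    split_ifs <;> simp
  rw [this]
  unfold frobSq
  have h : ∀ i : Fin r, ∑ j, ‖(Matrix.diagonal fun j : Fin r => if j.val < q then (0 : K) else 1) i j‖ ^ 2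
      = 1 - if i.val < q then 1 else 0 := by
    intro i
    rw [Finset.sum_eq_single i]
    · simp; split_ifs <;> simp
    · intro b _ hb
      rw [Matrix.diagonal_apply_ne _ hb.symm]; simp
    · simp
  simp only [h, Finset.sum_sub_distrib, Finset.sum_boole, Fin.card_filter_val_lt]
  simp [min_eq_right hqr]

/-- Residual of a projection dominates the approximation error. -/
lemma frobSq_proj_le {m : Type*} [Fintype m] [DecidableEq m] {n : Type*} [Fintype n]
    (P : Matrix m m K) (h1 : Pᴴ = P) (h2 : P * P = P) (X : Matrix m n K) :
    frobSq ((1 - P) * X) ≤ frobSq X := by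
  have : (frobSq X : K) = ((frobSq ((1 - P) * X) + frobSq (P * X) : ℝ) : K) := by
    rw [RCLike.ofReal_add, frobSq_trace, frobSq_trace, frobSq_trace]
    have e1 : (((1 - P) * X) * ((1 - P) * X)ᴴ).trace = ((1 - P) * (X * Xᴴ)).trace := by
      rw [conjTranspose_mul, conjTranspose_sub, conjTranspose_one, h1, Matrix.mul_assoc,
        Matrix.trace_mul_comm, Matrix.mul_assoc, Matrix.mul_assoc, Matrix.trace_mul_comm X,
        Matrix.mul_assoc, Matrix.mul_assoc, ← Matrix.mul_assoc (1 - P) (1 - P)]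
      simp only [Matrix.mul_sub, Matrix.sub_mul, h2, Matrix.mul_one, Matrix.one_mul, sub_self,
        sub_zero, Matrix.trace_sub]
      rw [Matrix.trace_mul_comm Xᴴ X, Matrix.trace_mul_comm Xᴴ (P * X), Matrix.mul_assoc]
    have e2 : ((P * X) * (P * X)ᴴ).trace = (P * (X * Xᴴ)).trace := by
      rw [conjTranspose_mul, h1, Matrix.mul_assoc,
        Matrix.trace_mul_comm, Matrix.mul_assoc, Matrix.mul_assoc, Matrix.trace_mul_comm X,
        Matrix.mul_assoc, Matrix.mul_assoc, ← Matrix.mul_assoc P P, h2,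
        Matrix.trace_mul_comm Xᴴ (P * X), Matrix.mul_assoc]
    rw [e1, e2, ← Matrix.trace_add, ← Matrix.add_mul, sub_add_cancel, Matrix.one_mul]
  have h3 : frobSq X = frobSq ((1 - P) * X) + frobSq (P * X) := by exact_mod_cast this
  have := frobSq_nonneg (P * X)
  linarith

lemma mp_proj {m n : ℕ} {A : Matrix (Fin m) (Fin n) K} {X : Matrix (Fin n) (Fin m) K}
    (h : IsMoorePenrose A X) : (A * X)ᴴ = A * X ∧ (A * X) * (A * X) = A * X ∧ (A * X).rank ≤ A.rank :=
  ⟨h.2.2.1, by rw [← Matrix.mul_assoc, h.1], rank_mul_le_left _ _⟩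

lemma Ahard_best (q N : ℕ) (hqr : q ≤ r) (hV : V ∈ Matrix.unitaryGroup (Fin r) K)
    (pinv : (m n : ℕ) → Matrix (Fin m) (Fin n) K → Matrix (Fin n) (Fin m) K)
    (hpinv : ∀ (m n : ℕ) (A : Matrix (Fin m) (Fin n) K), IsMoorePenrose A (pinv m n A)) :
    IsBestRankApprox q (Ahard hrd hrn (DD K r q N) V) (Ahard hrd hrn (DT K r q N) V) := by
  refine ⟨?_, fun B hB => ?_⟩
  · classical
    unfold Ahard
    refine (rank_mul_le_left _ _).trans ((rank_mul_le_right _ _).trans ?_)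
    unfold DT
    rw [rank_diagonal, Fintype.card_subtype]
    calc _ ≤ (Finset.univ.filter fun j : Fin r => j.val < q).card := by
          refine Finset.card_le_card fun j hj => ?_
          simp only [Finset.mem_filter, Finset.mem_univ, true_and] at hj ⊢
          by_contra hc
          simp [hc] at hj
      _ ≤ q := by rw [Fin.card_filter_val_lt]; exact min_le_right _ _
  · rw [frobSq_diff hrd hrn V hqr hV]
    obtain ⟨h1, h2, h3⟩ := mp_proj (hpinv d n B)
    set P := B * pinv d n B with hP
    have hPB : (1 - P) * B = 0 := by
      rw [Matrix.sub_mul, Matrix.one_mul, hP, (hpinv d n B).1, sub_self]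
    calc (r : ℝ) - q ≤ _ := sum_proj_le hrd P h1 h2 q (h3.trans hB)
      _ ≤ ∑ j : Fin r, wt q N j * (1 - RCLike.re (P (Fin.castLE hrd j) (Fin.castLE hrd j))) :=
        Finset.sum_le_sum fun j _ =>
          le_mul_of_one_le_left (compl_nonneg P h1 h2 _) (one_le_wt q N j)
      _ = frobSq ((1 - P) * Ahard hrd hrn (DD K r q N) V) := (num_eq hrd hrn V hV q N P h1 h2).symm
      _ = frobSq ((1 - P) * (Ahard hrd hrn (DD K r q N) V - B)) := by
        rw [Matrix.mul_sub, hPB, sub_zero]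
      _ ≤ _ := frobSq_proj_le P h1 h2 _

lemma num_lower {ℓ : ℕ} (q N : ℕ) (hV : V ∈ Matrix.unitaryGroup (Fin r) K)
    (W : Matrix (Fin n) (Fin ℓ) K) (X : Matrix (Fin ℓ) (Fin d) K)
    (hX : IsMoorePenrose (Ahard hrd hrn (DD K r q N) V * W) X) :
    ENNReal.ofReal ((r : ℝ) - ℓ) + ∑ i ∈ Finset.univ.filter (fun i : Fin r => i.val < q),
        hmin q N i (V * ((emb K hrn)ᴴ * W)) ≤
      ENNReal.ofReal (frobSq (Ahard hrd hrn (DD K r q N) V -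
        (Ahard hrd hrn (DD K r q N) V * W) * (X * Ahard hrd hrn (DD K r q N) V))) := by
  obtain ⟨h1, h2, h3⟩ := mp_proj hX
  set A := Ahard hrd hrn (DD K r q N) V with hA
  set P := A * W * X with hP
  set Z := V * ((emb K hrn)ᴴ * W) with hZ
  have hAW : A * W = emb K hrd * (DD K r q N * Z) := by
    rw [hA, Ahard, hZ]; simp only [Matrix.mul_assoc]
  have e0 : A - (A * W) * (X * A) = (1 - P) * A := by
    rw [Matrix.sub_mul, Matrix.one_mul, hP, Matrix.mul_assoc (A * W)]
  rw [e0, hA, num_eq hrd hrn V hV q N P h1 h2]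
  set c : Fin r → ℝ := fun j => 1 - RCLike.re (P (Fin.castLE hrd j) (Fin.castLE hrd j)) with hc
  have hc0 : ∀ j, 0 ≤ c j := fun j => compl_nonneg P h1 h2 _
  have hk : P.rank ≤ ℓ := h3.trans (rank_le_width _)
  have hfm : ∀ i : Fin r, fmin q N i Z ≤ ENNReal.ofReal (wt q N i * c i) := by
    intro i
    set Q : Matrix (Fin ℓ) (Fin r) K := X * (emb K hrd * DD K r q N) with hQ
    refine (iInf_le _ (Q.col i)).trans (le_of_eq ?_)
    congr 1
    have e1 : wt q N i * c i = ∑ b, ‖((1 - P) * (emb K hrd * DD K r q N) : Matrix (Fin d) (Fin r) K) b i‖ ^ 2 := by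
      unfold DD
      rw [emb_diag_col, proj_compl P h1 h2, sv_sq]
    have e2 : (1 - P) * (emb K hrd * DD K r q N) = emb K hrd * (DD K r q N * (1 - Z * Q)) := by
      rw [Matrix.sub_mul, Matrix.one_mul, hP, Matrix.mul_assoc (A * W), ← hQ, hAW,
        Matrix.mul_sub, Matrix.mul_one, Matrix.mul_sub]
      simp only [Matrix.mul_assoc]
    have e3 : ∀ Y : Matrix (Fin r) (Fin r) K,
        ∑ b, ‖(emb K hrd * Y) b i‖ ^ 2 = ∑ b, ‖Y b i‖ ^ 2 := by
      intro Y
      have := frobSq_emb_mul hrd (Y.submatrix id fun _ : Unit => i)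
      have e : emb K hrd * (Y.submatrix id fun _ : Unit => i) =
        (emb K hrd * Y).submatrix id fun _ : Unit => i := by
        ext; simp [Matrix.mul_apply]
      rw [e] at this
      simpa [frobSq] using this
    rw [e1, e2, e3]
    unfold fval
    refine Finset.sum_congr rfl fun b _ => ?_
    unfold DD
    rw [Matrix.diagonal_mul, norm_mul, mul_pow, RCLike.norm_ofReal, sq_abs, sv_sq]
    congr 3
    rw [Matrix.sub_apply, Matrix.one_apply, Pi.single_apply]
    rfl
  have hkap : 0 ≤ kap N := by
    unfold kap
    have : (1 / ((N : ℝ) + 1)) ^ 2 ≤ 1 := by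
      apply pow_le_one₀ (by positivity)
      rw [div_le_one (by positivity)]
      linarith [(Nat.cast_nonneg N : (0 : ℝ) ≤ N)]
    linarith
  have hwk : ∀ i : Fin r, 0 ≤ kap N * (wt q N i * c i) := fun i =>
    mul_nonneg hkap (mul_nonneg (wt_pos q N i).le (hc0 i))
  calc _ ≤ ENNReal.ofReal (∑ j, c j) + ∑ i ∈ Finset.univ.filter (fun i : Fin r => i.val < q),
        ENNReal.ofReal (kap N * (wt q N i * c i)) := by
        refine add_le_add (ENNReal.ofReal_le_ofReal (sum_proj_le hrd P h1 h2 ℓ hk))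
          (Finset.sum_le_sum fun i _ => ?_)
        rw [ENNReal.ofReal_mul hkap]
        exact mul_le_mul_right (hfm i) _
    _ = ENNReal.ofReal (∑ j, c j + ∑ i ∈ Finset.univ.filter (fun i : Fin r => i.val < q),
        kap N * (wt q N i * c i)) := by
        rw [← ENNReal.ofReal_sum_of_nonneg fun i _ => hwk i, ENNReal.ofReal_add]
        · exact Finset.sum_nonneg fun j _ => hc0 j
        · exact Finset.sum_nonneg fun i _ => hwk i
    _ = _ := by
        congr 1
        rw [Finset.sum_filter, ← Finset.sum_add_distrib]
        refine Finset.sum_congr rfl fun j _ => ?_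
        unfold kap wt
        split_ifs
        · have : (N : ℝ) + 1 ≠ 0 := by positivity
          field_simp
          ring
        · simp [hc]

end LinAlg

section Joint

variable {K : Type*} [RCLike K] [MeasurableSpace K] [BorelSpace K] {Y : Type*} [MeasurableSpace Y]
  {r ℓ : ℕ}

lemma hmin_joint (W : Y → Matrix (Fin r) (Fin ℓ) K) (hW : Measurable W) (q N : ℕ) (i : Fin r) :
    Measurable fun x : Matrix.unitaryGroup (Fin r) K × Y => hmin q N i (x.1.1 * W x.2) := by
  have h1 : Measurable fun x : Matrix.unitaryGroup (Fin r) K × Y => (x.1.1, W x.2) :=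
    (measurable_subtype_coe.comp measurable_fst).prodMk (hW.comp measurable_snd)
  have h2 : Continuous fun y : Matrix (Fin r) (Fin r) K × Matrix (Fin r) (Fin ℓ) K =>
    y.1 * y.2 := continuous_fst.matrix_mul continuous_snd
  exact (hmin_meas q N i).comp (h2.measurable.comp h1)

lemma hmin_left (W : Y → Matrix (Fin r) (Fin ℓ) K) (hW : Measurable W) (q N : ℕ) (i : Fin r)
    (V : Matrix.unitaryGroup (Fin r) K) :
    Measurable fun ω => hmin q N i (V.1 * W ω) := by
  have h2 : Continuous fun y : Matrix (Fin r) (Fin ℓ) K =>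
    V.1 * y := continuous_const.matrix_mul continuous_id
  exact (hmin_meas q N i).comp (h2.measurable.comp hW)

lemma hmin_right (W : Matrix (Fin r) (Fin ℓ) K) (q N : ℕ) (i : Fin r) :
    Measurable fun V : Matrix.unitaryGroup (Fin r) K => hmin q N i (V.1 * W) := by
  have h2 : Continuous fun V : Matrix.unitaryGroup (Fin r) K =>
    V.1 * W := continuous_subtype_val.matrix_mul continuous_const
  exact (hmin_meas q N i).comp h2.measurable

end Joint

/-- **Randomized SVD, sharp lower bound** (Theorem 3.3): for any full-rank random
embedding `Ω` and rank parameters `q + α_K < ℓ ≤ r ≤ min(d, n)`, the worst case over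
matrices `A` with `rank A = r` of `E‖A − Π_{AΩ}A‖_F² / ‖A − [A]_q‖_F²` is at least
`((r − ℓ)/(r − q)) (1 + q/(ℓ − q − α_K))`. -/
theorem randomized_svd_lower_bound
    {K : Type*} [RCLike K] [MeasurableSpace K] [BorelSpace K]
    {Y : Type*} [MeasurableSpace Y] (μ : Measure Y) [IsProbabilityMeasure μ]
    (pinv : (m n : ℕ) → Matrix (Fin m) (Fin n) K → Matrix (Fin n) (Fin m) K)
    (hpinv : ∀ (m n : ℕ) (A : Matrix (Fin m) (Fin n) K), IsMoorePenrose A (pinv m n A))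
    (n ℓ d q r : ℕ) (hℓn : ℓ ≤ n)
    (M : Y → Matrix (Fin n) (Fin ℓ) K)
    (hMmeas : Measurable M)
    (hMfull : ∀ᵐ ω ∂μ, (M ω).rank = ℓ)
    (hq : (q : ℝ) + alphaK K < (ℓ : ℝ)) (hℓr : ℓ ≤ r) (hrd : r ≤ d) (hrn : r ≤ n) :
    ENNReal.ofReal
        (((r : ℝ) - (ℓ : ℝ)) / ((r : ℝ) - (q : ℝ)) *
          (1 + (q : ℝ) / ((ℓ : ℝ) - (q : ℝ) - alphaK K))) ≤
      ⨆ (A : Matrix (Fin d) (Fin n) K) (Aq : Matrix (Fin d) (Fin n) K)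
        (_ : A.rank = r) (_ : IsBestRankApprox q A Aq),
        (∫⁻ ω, ENNReal.ofReal
            (frobSq (A - (A * M ω) * (pinv d ℓ (A * M ω) * A))) ∂μ) /
          ENNReal.ofReal (frobSq (A - Aq)) := by
  have hα : 0 ≤ alphaK K := by unfold alphaK; split_ifs <;> norm_num
  have hqlR : (q : ℝ) < ℓ := by linarith
  have hql : q < ℓ := by exact_mod_cast hqlR
  have hlrR : (ℓ : ℝ) ≤ r := by exact_mod_cast hℓr
  have hrq : 0 < (r : ℝ) - q := by linarith
  set s : ℝ≥0∞ := ⨆ (A : Matrix (Fin d) (Fin n) K) (Aq : Matrix (Fin d) (Fin n) K)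
        (_ : A.rank = r) (_ : IsBestRankApprox q A Aq),
        (∫⁻ ω, ENNReal.ofReal
            (frobSq (A - (A * M ω) * (pinv d ℓ (A * M ω) * A))) ∂μ) /
          ENNReal.ofReal (frobSq (A - Aq)) with hs
  set I := Finset.univ.filter (fun i : Fin r => i.val < q) with hI
  set c := ENNReal.ofReal ((r : ℝ) - q) with hc
  have hc0 : c ≠ 0 := by rw [hc]; exact (ENNReal.ofReal_pos.mpr hrq).ne'
  have hct : c ≠ ⊤ := ENNReal.ofReal_ne_top
  let W : Y → Matrix (Fin r) (Fin ℓ) K := fun ω => (emb K hrn)ᴴ * M ω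
  have hW : Measurable W := by
    have hcont : Continuous fun X : Matrix (Fin n) (Fin ℓ) K => (emb K hrn)ᴴ * X :=
      continuous_const.matrix_mul continuous_id
    exact hcont.measurable.comp hMmeas
  have hjoint := hmin_joint W hW q
  have hjl := hmin_left W hW q
  have hjr := fun N i ω => hmin_right (W ω) q N i
  -- pointwise bound
  have hpt : ∀ N (V : Matrix.unitaryGroup (Fin r) K),
      ENNReal.ofReal ((r : ℝ) - ℓ) + ∑ i ∈ I, ∫⁻ ω, hmin q N i (V.1 * W ω) ∂μ ≤ s * c := by
    intro N V
    have hA := le_iSup_of_le (f := fun A : Matrix (Fin d) (Fin n) K =>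
      ⨆ (Aq : Matrix (Fin d) (Fin n) K)
        (_ : A.rank = r) (_ : IsBestRankApprox q A Aq),
        (∫⁻ ω, ENNReal.ofReal
            (frobSq (A - (A * M ω) * (pinv d ℓ (A * M ω) * A))) ∂μ) /
          ENNReal.ofReal (frobSq (A - Aq))) (Ahard hrd hrn (DD K r q N) V.1)
      (le_iSup_of_le (Ahard hrd hrn (DT K r q N) V.1)
        (le_iSup_of_le (Ahard_rank hrd hrn V.1 V.2 q N)
          (le_iSup_of_le (Ahard_best hrd hrn V.1 q N (hql.le.trans hℓr) V.2 pinv hpinv) le_rfl)))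
    rw [← hs, frobSq_diff hrd hrn V.1 (hql.le.trans hℓr) V.2 N, ← hc,
      ENNReal.div_le_iff hc0 hct] at hA
    refine le_trans ?_ hA
    calc _ = ∫⁻ ω, (ENNReal.ofReal ((r : ℝ) - ℓ) + ∑ i ∈ I, hmin q N i (V.1 * W ω)) ∂μ := by
          rw [lintegral_add_left measurable_const, lintegral_finsetSum _ fun i _ => hjl N i V]
          simp
      _ ≤ _ := lintegral_mono fun ω =>
          num_lower hrd hrn V.1 q N V.2 (M ω) _ (hpinv d ℓ _)
  -- averaged bound
  have havg : ∀ N, ENNReal.ofReal ((r : ℝ) - ℓ) +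
      ∑ i ∈ I, ∫⁻ ω, ∫⁻ V, hmin q N i (V.1 * W ω) ∂(nuH r K) ∂μ ≤ s * c := by
    intro N
    have hm : ∀ i ∈ I, Measurable fun V : Matrix.unitaryGroup (Fin r) K =>
        ∫⁻ ω, hmin q N i (V.1 * W ω) ∂μ := fun i _ => (hjoint N i).lintegral_prod_right'
    calc _ = ∫⁻ V, (ENNReal.ofReal ((r : ℝ) - ℓ) + ∑ i ∈ I, ∫⁻ ω, hmin q N i (V.1 * W ω) ∂μ)
          ∂(nuH r K) := by
          rw [lintegral_add_left measurable_const, lintegral_finsetSum _ hm]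
          simp only [lintegral_const, measure_univ, mul_one]
          congr 1
          refine Finset.sum_congr rfl fun i _ => ?_
          exact (lintegral_lintegral_swap (μ := nuH r K) (ν := μ)
            (f := fun V ω => hmin q N i (V.1 * W ω)) (hjoint N i).aemeasurable).symm
      _ ≤ ∫⁻ V, s * c ∂(nuH r K) := lintegral_mono fun V => hpt N V
      _ = s * c := by simp
  have hmono : ∀ i : Fin r, Monotone fun N =>
      ∫⁻ ω, ∫⁻ V, hmin q N i (V.1 * W ω) ∂(nuH r K) ∂μ := fun i N N' h =>
    lintegral_mono fun ω => lintegral_mono fun V => hmin_mono q i _ h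
  have hlim : ENNReal.ofReal ((r : ℝ) - ℓ) +
      ∑ i ∈ I, ∫⁻ ω, ∫⁻ V, hsup q i (V.1 * W ω) ∂(nuH r K) ∂μ ≤ s * c := by
    have h1 : ∀ i : Fin r, ∫⁻ ω, ∫⁻ V, hsup q i (V.1 * W ω) ∂(nuH r K) ∂μ =
        ⨆ N, ∫⁻ ω, ∫⁻ V, hmin q N i (V.1 * W ω) ∂(nuH r K) ∂μ := by
      intro i
      rw [← lintegral_iSup (fun N => (hjoint N i).lintegral_prod_left')
        (fun N N' h ω => lintegral_mono fun V => hmin_mono q i _ h)]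
      refine lintegral_congr fun ω => ?_
      rw [← lintegral_iSup (fun N => hjr N i ω) (fun N N' h V => hmin_mono q i _ h)]
      rfl
    simp only [h1]
    rw [ENNReal.finsetSum_iSup_of_monotone hmono, ENNReal.add_iSup]
    exact iSup_le havg
  have hH : ENNReal.ofReal ((q : ℝ) * (((r : ℝ) - ℓ) / ((ℓ : ℝ) - q - alphaK K))) ≤
      ∑ i ∈ I, ∫⁻ ω, ∫⁻ V, hsup q i (V.1 * W ω) ∂(nuH r K) ∂μ := by
    have hm : ∀ i ∈ I, Measurable fun ω => ∫⁻ V : Matrix.unitaryGroup (Fin r) K,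
        hsup q i (V.1 * W ω) ∂(nuH r K) := fun i _ =>
      Measurable.lintegral_prod_left' (f := fun x : Matrix.unitaryGroup (Fin r) K × Y =>
        hsup q i (x.1.1 * W x.2)) (Measurable.iSup fun N => hjoint N i)
    rw [← lintegral_finsetSum _ hm]
    calc _ = ∫⁻ _ : Y, ENNReal.ofReal ((q : ℝ) * (((r : ℝ) - ℓ) / ((ℓ : ℝ) - q - alphaK K))) ∂μ := by
          simp
      _ ≤ _ := lintegral_mono fun ω => haar_total q hq hql.le hℓr (W ω)
  have hden : 0 < (ℓ : ℝ) - q - alphaK K := by linarith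
  have hfin : ENNReal.ofReal (((r : ℝ) - ℓ) + (q : ℝ) * (((r : ℝ) - ℓ) / ((ℓ : ℝ) - q - alphaK K)))
      ≤ s * c := by
    rw [ENNReal.ofReal_add (by linarith)
      (mul_nonneg (by positivity) (div_nonneg (by linarith) hden.le))]
    exact (add_le_add le_rfl hH).trans hlim
  rw [← ENNReal.div_le_iff hc0 hct, hc, ← ENNReal.ofReal_div_of_pos hrq] at hfin
  refine le_trans (le_of_eq ?_) hfin
  congr 1
  field_simp
end
end

section
/- Gram correspondence: let Ω ∈ K^{n×ℓ} and A ∈ K^{d×n} be matrices, let Â := (AΩ)(AΩ)⁺A be the randomized SVD approximation of A, and let Ĥ := H⟨Ω⟩ be the Nyström approximation of the Gram matrix H := A*A. Then Ĥ = Â*Â and tr(H − Ĥ) = ‖A − Â‖_F². -/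
open MeasureTheory ProbabilityTheory Matrix Filter
open scoped ENNReal Topology ComplexOrder

noncomputable section

theorem frobSq_eq_trace {K : Type*} [RCLike K] {m n : Type*} [Fintype m] [Fintype n]
    (M : Matrix m n K) : ((frobSq M : ℝ) : K) = Matrix.trace (Mᴴ * M) := by
  simp only [frobSq, Matrix.trace, Matrix.diag, Matrix.mul_apply, Matrix.conjTranspose_apply]
  rw [Finset.sum_comm]
  push_cast
  refine Finset.sum_congr rfl fun i _ => Finset.sum_congr rfl fun j _ => ?_
  rw [RCLike.star_def, RCLike.conj_mul]

/-- If `X = B⁺` and `Y = (B* B)⁺` then `B Y B* = B X`. -/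
theorem proj_eq {K : Type*} [RCLike K] {m n : Type*} [Fintype m] [Fintype n]
    (B : Matrix m n K) (X : Matrix n m K) (Y : Matrix n n K)
    (hX : IsMoorePenrose B X) (hY : IsMoorePenrose (Bᴴ * B) Y) :
    B * Y * Bᴴ = B * X := by
  classical
  obtain ⟨h1, -, h3, -⟩ := hX
  obtain ⟨g1, -, -, -⟩ := hY
  have hB : B * Y * (Bᴴ * B) = B := by
    have h : (Bᴴ * B) * (Y * (Bᴴ * B) - 1) = 0 := by
      rw [Matrix.mul_sub, ← Matrix.mul_assoc, g1, Matrix.mul_one, sub_self]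
    rw [Matrix.conjTranspose_mul_self_mul_eq_zero] at h
    rw [Matrix.mul_sub, Matrix.mul_one, sub_eq_zero] at h
    rw [Matrix.mul_assoc, h]
  have hP : Bᴴ * (B * X) = Bᴴ := by
    have := congrArg Matrix.conjTranspose h1
    rwa [Matrix.conjTranspose_mul, h3] at this
  calc B * Y * Bᴴ = B * Y * (Bᴴ * (B * X)) := by rw [hP]
    _ = (B * Y * (Bᴴ * B)) * X := by simp only [Matrix.mul_assoc]
    _ = B * X := by rw [hB]

/-- **Gram correspondence** (Fact 3.5): with `Â = (AΩ)(AΩ)⁺A` the randomized SVD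
approximation of `A` and `Ĥ = H⟨Ω⟩` the Nyström approximation of the Gram matrix
`H = A*A`, one has `Ĥ = Â*Â` and `tr(H − Ĥ) = ‖A − Â‖_F²`. -/
theorem gram_correspondence
    {K : Type*} [RCLike K]
    (pinv : (m n : ℕ) → Matrix (Fin m) (Fin n) K → Matrix (Fin n) (Fin m) K)
    (hpinv : ∀ (m n : ℕ) (A : Matrix (Fin m) (Fin n) K), IsMoorePenrose A (pinv m n A))
    (n ℓ d : ℕ) (hℓn : ℓ ≤ n)
    (Om : Matrix (Fin n) (Fin ℓ) K) (A : Matrix (Fin d) (Fin n) K) :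
    (Aᴴ * A) * Om * (pinv ℓ ℓ (Omᴴ * (Aᴴ * A) * Om) * (Omᴴ * (Aᴴ * A)))
        = ((A * Om) * (pinv d ℓ (A * Om) * A))ᴴ * ((A * Om) * (pinv d ℓ (A * Om) * A)) ∧
      Matrix.trace (Aᴴ * A -
          (Aᴴ * A) * Om * (pinv ℓ ℓ (Omᴴ * (Aᴴ * A) * Om) * (Omᴴ * (Aᴴ * A))))
        = ((frobSq (A - (A * Om) * (pinv d ℓ (A * Om) * A)) : ℝ) : K) := by
  have hX := hpinv d ℓ (A * Om)
  have hG : Omᴴ * (Aᴴ * A) * Om = (A * Om)ᴴ * (A * Om) := by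
    simp only [Matrix.conjTranspose_mul, Matrix.mul_assoc]
  have hY := hpinv ℓ ℓ (Omᴴ * (Aᴴ * A) * Om)
  generalize pinv ℓ ℓ (Omᴴ * (Aᴴ * A) * Om) = Y at *
  generalize pinv d ℓ (A * Om) = X at *
  rw [hG] at hY
  have hP := proj_eq _ _ _ hX hY
  obtain ⟨h1, -, h3, -⟩ := hX
  have hL : (Aᴴ * A) * Om * (Y * (Omᴴ * (Aᴴ * A))) = Aᴴ * ((A * Om * X) * A) := by
    rw [← hP]
    simp only [Matrix.conjTranspose_mul, Matrix.mul_assoc]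
  have hA : (A * Om) * (X * A) = (A * Om * X) * A := by simp only [Matrix.mul_assoc]
  have hPP : (A * Om * X) * (A * Om * X) = A * Om * X := by
    rw [← Matrix.mul_assoc (A * Om * X) (A * Om) X, h1]
  rw [frobSq_eq_trace, hL, hA]
  generalize A * Om * X = P at *
  have hPA : (P * A)ᴴ * (P * A) = Aᴴ * (P * A) := by
    rw [Matrix.conjTranspose_mul, h3, Matrix.mul_assoc, ← Matrix.mul_assoc P P A, hPP]
  refine ⟨hPA.symm, ?_⟩
  have h4 : (P * A)ᴴ * A = Aᴴ * (P * A) := by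
    rw [Matrix.conjTranspose_mul, h3, Matrix.mul_assoc]
  rw [Matrix.conjTranspose_sub, Matrix.sub_mul, Matrix.mul_sub, Matrix.mul_sub, hPA, h4, sub_self,
    sub_zero]
end
end
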